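/- arXiv:2204.10414 — 3 statements merged into one kernel-verified Lean document; each statement's English description precedes it below -/
import Mathlib

section
/- Under the two-level hierarchical linear regression model with proportion moments matching a symmetric Dirichlet distribution Dir(α) with α_i = 1/K (i.e., p_i = 1/K and s_i = (1/K)(1−1/K)/2 for all i ∈ {1,…,K}), and with θ₀ᵀΣθ₀ = σ², if n ≥ max(2d, 6), then the ratio of total expected excess risks satisfies (Σ_{i=1}^K E[r_i(θ̂ᵇ_i)]) / (Σ_{i=1}^K E[r_i(θ̂ᵗ_i)]) ≥ min(d, K)/9. -/
open MeasureTheory ProbabilityTheory Matrix Finset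

noncomputable section

/-- The product of `d` independent standard Gaussians on `Fin d → ℝ`. -/
def stdGaussianPi (d : ℕ) : Measure (Fin d → ℝ) :=
  Measure.pi fun _ => gaussianReal 0 1

/-- `μ` is the centered multivariate Gaussian distribution on `ℝ^d` with covariance
matrix `C`, i.e. the law of `A z` where `z` is a standard Gaussian vector and `A Aᵀ = C`. -/
def IsCenteredGaussian {d : ℕ} (μ : Measure (Fin d → ℝ))
    (C : Matrix (Fin d) (Fin d) ℝ) : Prop :=
  ∃ A : Matrix (Fin d) (Fin d) ℝ, A * Aᵀ = C ∧ μ = (stdGaussianPi d).map (fun z => A.mulVec z)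

/-- Sample space for the two-level hierarchical linear regression model with `n` time steps:
a point `ω = (x, η, a)` records the covariates `x t : ℝ^d`, the noises `η t : ℝ`, and the
proportion vectors `a t : ℝ^K`, for `t = 1, …, n`. -/
abbrev HierOmega (d n K : ℕ) : Type :=
  (Fin n → (Fin d → ℝ)) × (Fin n → ℝ) × (Fin n → (Fin K → ℝ))

/-- The joint law of the model: the covariates are i.i.d. with law `νx`, the noises are
i.i.d. with law `νη`, the proportion vectors are i.i.d. with law `νa`, and the three
families are mutually independent. -/
def hierMeasure (d n K : ℕ) (νx : Measure (Fin d → ℝ)) (νη : Measure ℝ)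
    (νa : Measure (Fin K → ℝ)) : Measure (HierOmega d n K) :=
  (Measure.pi fun _ : Fin n => νx).prod
    ((Measure.pi fun _ : Fin n => νη).prod (Measure.pi fun _ : Fin n => νa))

variable {d n K : ℕ}

/-- The empirical second-moment matrix `S = ∑ t, x_t x_tᵀ`. -/
def Smat (ω : HierOmega d n K) : Matrix (Fin d) (Fin d) ℝ :=
  ∑ t, vecMulVec (ω.1 t) (ω.1 t)

/-- The root value at time `t`: `y_{t,0} = θ₀ᵀ x_t + η_t`. -/
def yRoot (θ₀ : Fin d → ℝ) (t : Fin n) (ω : HierOmega d n K) : ℝ :=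
  θ₀ ⬝ᵥ ω.1 t + ω.2.1 t

/-- The value of child `i` at time `t`: `y_{t,i} = a_{t,i} · y_{t,0}`. -/
def yChild (θ₀ : Fin d → ℝ) (i : Fin K) (t : Fin n) (ω : HierOmega d n K) : ℝ :=
  ω.2.2 t i * yRoot θ₀ t ω

/-- The bottom-up OLS estimator for child `i`: `θ̂ᵇ_i = S⁻¹ ∑ t, x_t y_{t,i}`. -/
def thetaBU (θ₀ : Fin d → ℝ) (i : Fin K) (ω : HierOmega d n K) : Fin d → ℝ :=
  (Smat ω)⁻¹.mulVec (∑ t, yChild θ₀ i t ω • ω.1 t)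

/-- The root OLS estimator `θ̂₀ = S⁻¹ ∑ t, x_t y_{t,0}`. -/
def thetaRoot (θ₀ : Fin d → ℝ) (ω : HierOmega d n K) : Fin d → ℝ :=
  (Smat ω)⁻¹.mulVec (∑ t, yRoot θ₀ t ω • ω.1 t)

/-- The estimated proportion `p̂_i = (1/n) ∑ t, a_{t,i}`. -/
def pHat (i : Fin K) (ω : HierOmega d n K) : ℝ :=
  (∑ t, ω.2.2 t i) / n

/-- The top-down estimator for child `i`: `θ̂ᵗ_i = p̂_i θ̂₀`. -/
def thetaTD (θ₀ : Fin d → ℝ) (i : Fin K) (ω : HierOmega d n K) : Fin d → ℝ :=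
  pHat i ω • thetaRoot θ₀ ω

/-- The excess risk of an estimate `est` for the target coefficient vector `tgt`,
with respect to the covariance `C`: `(est − tgt)ᵀ C (est − tgt)`. -/
def excessRisk (C : Matrix (Fin d) (Fin d) ℝ) (tgt est : Fin d → ℝ) : ℝ :=
  (est - tgt) ⬝ᵥ C.mulVec (est - tgt)

/-- The regularized Gram matrix `∑ t, x_t x_tᵀ + ε I`. -/
def regGram {n d : ℕ} (ε : ℝ) (X : Fin n → Fin d → ℝ) : Matrix (Fin d) (Fin d) ℝ :=
  ∑ t, vecMulVec (X t) (X t) + ε • 1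

section RegGram

variable {n d : ℕ}

lemma regGram_isSymm (ε : ℝ) (X : Fin n → Fin d → ℝ) : (regGram ε X)ᵀ = regGram ε X := by
  simp [regGram, transpose_sum, transpose_vecMulVec]

lemma regGram_mulVec (ε : ℝ) (X : Fin n → Fin d → ℝ) (v : Fin d → ℝ) :
    regGram ε X *ᵥ v = ∑ t, (X t ⬝ᵥ v) • X t + ε • v := by
  simp only [regGram, add_mulVec, sum_mulVec, smul_mulVec, one_mulVec, vecMulVec_mulVec]
  congr 1
  refine Finset.sum_congr rfl fun t _ => ?_
  ext j
  simp [mul_comm]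

lemma dotProduct_regGram_mulVec (ε : ℝ) (X : Fin n → Fin d → ℝ) (v : Fin d → ℝ) :
    v ⬝ᵥ regGram ε X *ᵥ v = ∑ t, (X t ⬝ᵥ v) ^ 2 + ε * ∑ j, v j ^ 2 := by
  rw [regGram_mulVec, dotProduct_add, dotProduct_sum]
  simp only [dotProduct_smul, smul_eq_mul]
  congr 1
  · refine Finset.sum_congr rfl fun t _ => ?_
    rw [dotProduct_comm v, sq]
  · simp [dotProduct, sq]

lemma regGram_inv_apply_self (ε : ℝ) (X : Fin n → Fin d → ℝ) (k : Fin d)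
    (hdet : IsUnit (regGram ε X).det) :
    (regGram ε X)⁻¹ k k = ∑ t, (X t ⬝ᵥ (regGram ε X)⁻¹ *ᵥ Pi.single k 1) ^ 2 +
      ε * ∑ j, ((regGram ε X)⁻¹ *ᵥ Pi.single k 1) j ^ 2 := by
  rw [← dotProduct_regGram_mulVec, mulVec_mulVec, mul_nonsing_inv _ hdet, one_mulVec]
  simp

lemma regGram_inv_apply_self_nonneg {ε : ℝ} (hε : 0 ≤ ε) (X : Fin n → Fin d → ℝ) (k : Fin d) :
    0 ≤ (regGram ε X)⁻¹ k k := by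
  by_cases hdet : IsUnit (regGram ε X).det
  · rw [regGram_inv_apply_self ε X k hdet]
    positivity
  · simp [nonsing_inv_apply_not_isUnit _ hdet]

lemma measurable_regGram_apply (ε : ℝ) (i j : Fin d) :
    Measurable fun X : Fin n → Fin d → ℝ => regGram ε X i j := by
  simp only [regGram, Matrix.add_apply, Matrix.sum_apply, vecMulVec_apply]
  fun_prop

end RegGram

lemma measurable_matrix_inv_apply {Ω : Type*} [MeasurableSpace Ω] {d : ℕ}
    {M : Ω → Matrix (Fin d) (Fin d) ℝ} (hM : ∀ i j, Measurable fun ω => M ω i j) (i j : Fin d) :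
    Measurable fun ω => (M ω)⁻¹ i j := by
  have hdet : ∀ {N : Ω → Matrix (Fin d) (Fin d) ℝ}, (∀ i j, Measurable fun ω => N ω i j) →
      Measurable fun ω => (N ω).det := by
    intro N hN
    simp only [det_apply]
    refine Finset.measurable_sum _ fun σ _ => ?_
    exact (Finset.measurable_prod _ fun i _ => hN _ _).const_smul _
  simp only [Matrix.inv_def, Matrix.smul_apply, Ring.inverse_eq_inv', smul_eq_mul, adjugate_apply]
  refine (hdet hM).inv.mul (hdet fun a b => ?_)
  by_cases h : a = j
  · subst h
    simp
  · simpa [updateRow_ne h] using hM a b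

lemma regGram_inv_mul_le_one {n d : ℕ} {ε : ℝ} (hε : 0 ≤ ε) (X : Fin n → Fin d → ℝ) (k : Fin d)
    (b : OrthonormalBasis (Fin n) ℝ (EuclideanSpace ℝ (Fin n))) (s : Finset (Fin n))
    (hb : ∀ i ∈ s, ∀ j, j ≠ k → b.repr (WithLp.toLp 2 fun t => X t j) i = 0) :
    (regGram ε X)⁻¹ k k * ∑ i ∈ s, (b.repr (WithLp.toLp 2 fun t => X t k) i) ^ 2 ≤ 1 := by
  by_cases hdet : IsUnit (regGram ε X).det
  swap
  · simp [nonsing_inv_apply_not_isUnit _ hdet]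
  have h := regGram_inv_apply_self ε X k hdet
  have hnn := regGram_inv_apply_self_nonneg hε X k
  set v := (regGram ε X)⁻¹ *ᵥ Pi.single k 1 with hv
  have hvk : v k = (regGram ε X)⁻¹ k k := by simp [hv]
  have hlin : (WithLp.toLp 2 fun t => X t ⬝ᵥ v : EuclideanSpace ℝ (Fin n)) =
      ∑ j, v j • WithLp.toLp 2 fun t => X t j := by
    ext t
    simp [dotProduct, mul_comm]
  have hcoord : ∀ i ∈ s, b.repr (WithLp.toLp 2 fun t => X t ⬝ᵥ v) i =
      v k * b.repr (WithLp.toLp 2 fun t => X t k) i := by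
    intro i hi
    rw [hlin, map_sum]
    simp only [map_smul, WithLp.ofLp_sum, WithLp.ofLp_smul, Finset.sum_apply, Pi.smul_apply,
      smul_eq_mul]
    refine Finset.sum_eq_single k (fun j _ hj => ?_) (by simp)
    rw [hb i hi j hj, mul_zero]
  have hnorm : ∑ i, (b.repr (WithLp.toLp 2 fun t => X t ⬝ᵥ v) i) ^ 2 = ∑ t, (X t ⬝ᵥ v) ^ 2 := by
    rw [← EuclideanSpace.real_norm_sq_eq, b.repr.norm_map, EuclideanSpace.real_norm_sq_eq]
  have hle : v k ^ 2 * ∑ i ∈ s, (b.repr (WithLp.toLp 2 fun t => X t k) i) ^ 2 ≤ v k := by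
    calc _ = ∑ i ∈ s, (b.repr (WithLp.toLp 2 fun t => X t ⬝ᵥ v) i) ^ 2 := by
          rw [Finset.mul_sum]
          exact Finset.sum_congr rfl fun i hi => by rw [hcoord i hi, mul_pow]
      _ ≤ ∑ i, (b.repr (WithLp.toLp 2 fun t => X t ⬝ᵥ v) i) ^ 2 :=
          Finset.sum_le_univ_sum_of_nonneg fun i => sq_nonneg _
      _ ≤ v k := by
          rw [hnorm, hvk, h]
          exact le_add_of_nonneg_right (mul_nonneg hε (Finset.sum_nonneg fun j _ => sq_nonneg _))
  rw [← hvk] at hnn ⊢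
  rcases hnn.eq_or_lt with h0 | h0
  · simp [← h0]
  · have := le_of_mul_le_mul_left (a := v k)
      (b := v k * ∑ i ∈ s, (b.repr (WithLp.toLp 2 fun t => X t k) i) ^ 2) (c := 1)
      (by linarith [hle, sq (v k)]) h0
    exact this

lemma exists_orthonormalBasis_orthogonal {n m r : ℕ} (h : m + r ≤ n)
    (w : Fin m → EuclideanSpace ℝ (Fin n)) :
    ∃ b : OrthonormalBasis (Fin n) ℝ (EuclideanSpace ℝ (Fin n)),
      ∀ i : Fin n, (i : ℕ) < r → ∀ j, b.repr (w j) i = 0 := by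
  set V := Submodule.span ℝ (Set.range w)
  have hV : Module.finrank ℝ V ≤ m := by
    simpa using! finrank_range_le_card (R := ℝ) (b := w)
  have hVo : r ≤ Module.finrank ℝ Vᗮ := by
    have := V.finrank_add_finrank_orthogonal
    simp only [finrank_euclideanSpace, Fintype.card_fin] at this
    omega
  set u := stdOrthonormalBasis ℝ Vᗮ
  let v : Fin n → EuclideanSpace ℝ (Fin n) := fun i =>
    if hi : (i : ℕ) < r then (u ⟨i, hi.trans_le hVo⟩ : EuclideanSpace ℝ (Fin n)) else 0
  have hvo : Orthonormal ℝ (({i : Fin n | (i : ℕ) < r} : Set (Fin n)).domRestrict v) := by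
    have h1 := (u.orthonormal.comp_linearIsometry Vᗮ.subtypeₗᵢ).comp
      (fun i : ({i : Fin n | (i : ℕ) < r} : Set (Fin n)) =>
        (⟨(i : Fin n), lt_of_lt_of_le i.2 hVo⟩ : Fin (Module.finrank ℝ Vᗮ)))
      (fun i j hij => by
        apply Subtype.ext
        apply Fin.ext
        simpa using hij)
    convert h1 using 1
    funext i
    have hi : ((i : Fin n) : ℕ) < r := i.2
    simp [v, hi, Set.domRestrict]
  obtain ⟨b, hb⟩ := hvo.exists_orthonormalBasis_extension_of_card_eq (by simp)
  refine ⟨b, fun i hi j => ?_⟩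
  rw [b.repr_apply_apply, hb i hi]
  simp only [v, hi, dif_pos]
  exact V.inner_left_of_mem_orthogonal (Submodule.subset_span ⟨j, rfl⟩) (Subtype.property _)

section GaussianRow

lemma integrable_rpow_neg_third_mul_gaussianReal :
    Integrable (fun x : ℝ => (x ^ 2) ^ (-(1 / 3) : ℝ) * (1 + x ^ 2)) (gaussianReal 0 1) := by
  have hbase : Integrable fun x : ℝ => x ^ (-(2 / 3) : ℝ) * Real.exp (-(1 / 4) * x ^ 2) :=
    integrable_rpow_mul_exp_neg_mul_sq (by norm_num) (by norm_num)
  have hdom : Integrable fun x : ℝ =>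
      4 * (√(2 * Real.pi * (1 : NNReal)))⁻¹ *
        (‖x ^ (-(2 / 3) : ℝ) * Real.exp (-(1 / 4) * x ^ 2)‖ +
          ‖(-x) ^ (-(2 / 3) : ℝ) * Real.exp (-(1 / 4) * (-x) ^ 2)‖) :=
    (hbase.norm.add hbase.comp_neg.norm).const_mul _
  rw [gaussianReal_of_var_ne_zero _ one_ne_zero,
    integrable_withDensity_iff_integrable_smul' (measurable_gaussianPDF 0 1)
      (Filter.Eventually.of_forall fun _ => gaussianPDF_lt_top)]
  simp only [toReal_gaussianPDF, smul_eq_mul]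
  refine hdom.mono' ?_ (Filter.Eventually.of_forall fun x => ?_)
  · refine Measurable.aestronglyMeasurable ?_
    have := measurable_gaussianPDFReal 0 1
    fun_prop
  rw [Real.norm_of_nonneg (by have := gaussianPDFReal_nonneg 0 1 x; positivity), gaussianPDFReal]
  have h1 : (x ^ 2) ^ (-(1 / 3) : ℝ) = |x| ^ (-(2 / 3) : ℝ) := by
    rw [← sq_abs, ← Real.rpow_natCast, ← Real.rpow_mul (abs_nonneg x)]
    norm_num
  have h2 : |x| ^ (-(2 / 3) : ℝ) ≤ |x ^ (-(2 / 3) : ℝ)| + |(-x) ^ (-(2 / 3) : ℝ)| := by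
    rcases le_total 0 x with h | h
    · rw [abs_of_nonneg h]
      exact (le_abs_self _).trans (le_add_of_nonneg_right (abs_nonneg _))
    · rw [abs_of_nonpos h]
      exact (le_abs_self _).trans (le_add_of_nonneg_left (abs_nonneg _))
  have h3 : Real.exp (-(x - 0) ^ 2 / (2 * (1 : NNReal))) * (1 + x ^ 2) ≤
      4 * Real.exp (-(1 / 4) * x ^ 2) := by
    have e : Real.exp (-(x - 0) ^ 2 / (2 * (1 : NNReal))) =
        Real.exp (-(1 / 4) * x ^ 2) * Real.exp (-(1 / 4) * x ^ 2) := by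
      rw [← Real.exp_add]
      congr 1
      push_cast
      ring
    have e2 : Real.exp (-(1 / 4) * x ^ 2) * (1 + x ^ 2) ≤ 4 := by
      have := Real.add_one_le_exp (1 / 4 * x ^ 2)
      have hp := Real.exp_pos (-(1 / 4) * x ^ 2)
      calc _ ≤ Real.exp (-(1 / 4) * x ^ 2) * (4 * Real.exp (1 / 4 * x ^ 2)) := by
            gcongr
            nlinarith
        _ = 4 := by
            rw [mul_left_comm, ← Real.exp_add]
            simp
    rw [e, mul_assoc, mul_comm]
    exact mul_le_mul_of_nonneg_right e2 (Real.exp_pos _).le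
  rw [h1]
  simp only [norm_mul, Real.norm_eq_abs, Real.abs_exp, neg_sq]
  rw [← add_mul]
  have hc : 0 ≤ (√(2 * Real.pi * (1 : NNReal)))⁻¹ := by positivity
  calc _ = (√(2 * Real.pi * (1 : NNReal)))⁻¹ * (|x| ^ (-(2 / 3) : ℝ) *
        (Real.exp (-(x - 0) ^ 2 / (2 * (1 : NNReal))) * (1 + x ^ 2))) := by ring
    _ ≤ (√(2 * Real.pi * (1 : NNReal)))⁻¹ *
        ((|x ^ (-(2 / 3) : ℝ)| + |(-x) ^ (-(2 / 3) : ℝ)|) *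
          (4 * Real.exp (-(1 / 4) * x ^ 2))) := by gcongr
    _ = _ := by ring

lemma integrable_one_add_sq_gaussianReal :
    Integrable (fun x : ℝ => 1 + x ^ 2) (gaussianReal 0 1) :=
  (integrable_const 1).add (memLp_id_gaussianReal 2).integrable_sq

/-- A product weight on Gaussian coordinates that dominates the diagonal entries of the inverse
Gram matrix. -/
def rowWeight (n : ℕ) (g : Fin n → ℝ) : ℝ :=
  ∏ i : Fin n, (if (i : ℕ) < 3 then (g i ^ 2) ^ (-(1 / 3) : ℝ) else 1) * (1 + g i ^ 2)

lemma integrable_rowWeight (n : ℕ) : Integrable (rowWeight n) (stdGaussianPi n) := by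
  refine Integrable.fintype_prod
    (f := fun (i : Fin n) (x : ℝ) =>
      (if (i : ℕ) < 3 then (x ^ 2) ^ (-(1 / 3) : ℝ) else 1) * (1 + x ^ 2)) fun i => ?_
  by_cases hi : (i : ℕ) < 3
  · simpa [hi] using integrable_rpow_neg_third_mul_gaussianReal
  · simpa [hi] using integrable_one_add_sq_gaussianReal

instance (d : ℕ) : IsProbabilityMeasure (stdGaussianPi d) := by
  unfold stdGaussianPi; infer_instance

lemma measurePreserving_repr_stdGaussianPi {n : ℕ}
    (b : OrthonormalBasis (Fin n) ℝ (EuclideanSpace ℝ (Fin n))) :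
    MeasurePreserving (fun r : Fin n → ℝ => WithLp.ofLp (b.repr (WithLp.toLp 2 r)))
      (stdGaussianPi n) (stdGaussianPi n) := by
  refine ⟨by fun_prop, ?_⟩
  have h1 : (stdGaussianPi n).map (WithLp.toLp 2) = stdGaussian (EuclideanSpace ℝ (Fin n)) :=
    map_pi_eq_stdGaussian
  have h2 : (stdGaussian (EuclideanSpace ℝ (Fin n))).map (fun x => WithLp.ofLp x) =
      stdGaussianPi n := by
    rw [← h1, Measure.map_map (by fun_prop) (by fun_prop)]
    exact Measure.map_id
  have h3 := stdGaussian_map b.repr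
  calc _ = (((stdGaussianPi n).map (WithLp.toLp 2)).map b.repr).map (fun x => WithLp.ofLp x) := by
        rw [Measure.map_map (by fun_prop) (by fun_prop),
          Measure.map_map (by fun_prop) (by fun_prop)]
        rfl
    _ = _ := by rw [h1, h3, h2]

lemma ae_ne_zero_stdGaussianPi (n : ℕ) : ∀ᵐ g ∂stdGaussianPi n, ∀ i, g i ≠ 0 := by
  have := nullSingletonClass_gaussianReal (μ := 0) (v := 1) one_ne_zero
  refine ae_all_iff.2 fun i => ?_
  have h : ∀ᵐ x ∂gaussianReal 0 1, x ≠ 0 := by simp [ae_iff]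
  exact (measurePreserving_eval (fun _ : Fin n => gaussianReal 0 1) i).quasiMeasurePreserving.ae h

lemma one_add_sum_le_prod_one_add {ι : Type*} (s : Finset ι) {f : ι → ℝ}
    (hf : ∀ i ∈ s, 0 ≤ f i) : 1 + ∑ i ∈ s, f i ≤ ∏ i ∈ s, (1 + f i) := by
  induction s using Finset.cons_induction with
  | empty => simp
  | cons a s ha ih =>
    rw [Finset.sum_cons, Finset.prod_cons]
    have h1 := ih fun i hi => hf i (Finset.mem_cons_of_mem hi)
    have h2 := hf a (Finset.mem_cons_self a s)
    have h3 : 0 ≤ ∑ i ∈ s, f i := Finset.sum_nonneg fun i hi => hf i (Finset.mem_cons_of_mem hi)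
    nlinarith [mul_nonneg h2 h3]

lemma mul_one_add_sum_le_rowWeight {n : ℕ} (hn : 3 ≤ n) {g : Fin n → ℝ} (hg : ∀ i, g i ≠ 0)
    {v : ℝ} (hv : v * ∑ i ∈ univ.filter (fun i : Fin n => (i : ℕ) < 3), g i ^ 2 ≤ 1) :
    v * (1 + ∑ i, g i ^ 2) ≤ rowWeight n g := by
  set s := univ.filter (fun i : Fin n => (i : ℕ) < 3) with hs
  set q := ∑ i ∈ s, g i ^ 2 with hq
  have hcard : s.card = 3 := by
    rw [hs, Fin.card_filter_val_lt]
    omega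
  have hqpos : 0 < q := by
    refine Finset.sum_pos (fun i _ => by have := hg i; positivity) ?_
    rw [← Finset.card_pos, hcard]
    norm_num
  have h1 : q⁻¹ ≤ ∏ i ∈ s, (g i ^ 2) ^ (-(1 / 3) : ℝ) := by
    have : q⁻¹ = ∏ _i ∈ s, q ^ (-(1 / 3) : ℝ) := by
      rw [Finset.prod_const, hcard, ← Real.rpow_natCast, ← Real.rpow_mul hqpos.le,
        ← Real.rpow_neg_one]
      norm_num
    rw [this]
    refine Finset.prod_le_prod (fun _ _ => by positivity) fun i hi => ?_
    refine Real.rpow_le_rpow_of_nonpos (by have := hg i; positivity) ?_ (by norm_num)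
    exact Finset.single_le_sum (f := fun i => g i ^ 2) (fun j _ => sq_nonneg _) hi
  have h2 : v ≤ q⁻¹ := by
    rw [← one_div]
    exact (le_div_iff₀ hqpos).2 hv
  have h3 : 1 + ∑ i, g i ^ 2 ≤ ∏ i, (1 + g i ^ 2) :=
    one_add_sum_le_prod_one_add _ fun i _ => sq_nonneg _
  have h4 : ∏ i : Fin n, (if (i : ℕ) < 3 then (g i ^ 2) ^ (-(1 / 3) : ℝ) else 1) =
      ∏ i ∈ s, (g i ^ 2) ^ (-(1 / 3) : ℝ) := by
    rw [hs, Finset.prod_filter]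
  rw [rowWeight, Finset.prod_mul_distrib, h4]
  exact mul_le_mul (h2.trans h1) h3 (by positivity) (Finset.prod_nonneg fun _ _ => by positivity)

end GaussianRow

section InverseGram

lemma regGram_det_isUnit {n d : ℕ} {ε : ℝ} (hε : 0 < ε) (X : Fin n → Fin d → ℝ) :
    IsUnit (regGram ε X).det := by
  rw [isUnit_iff_ne_zero]
  intro h
  obtain ⟨v, hv0, hv⟩ := exists_mulVec_eq_zero_iff.2 h
  have h1 := dotProduct_regGram_mulVec ε X v
  rw [hv, dotProduct_zero] at h1
  have h2 : 0 ≤ ∑ t, (X t ⬝ᵥ v) ^ 2 := Finset.sum_nonneg fun _ _ => sq_nonneg _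
  obtain ⟨j, hj⟩ := Function.ne_iff.1 hv0
  have h3 : 0 < ∑ j, v j ^ 2 :=
    Finset.sum_pos' (fun _ _ => sq_nonneg _) ⟨j, Finset.mem_univ j, by
      have : v j ≠ 0 := hj
      positivity⟩
  nlinarith [mul_pos hε h3]

lemma one_le_mul_trace_regGram_inv {n d : ℕ} {ε : ℝ} (hε : 0 < ε) (X : Fin n → Fin d → ℝ)
    (hdet : (regGram 0 X).det = 0) : 1 ≤ ε * ∑ k, (regGram ε X)⁻¹ k k := by
  obtain ⟨u, hu0, hu⟩ := exists_mulVec_eq_zero_iff.2 hdet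
  have hunit := regGram_det_isUnit hε X
  have hSu : regGram ε X *ᵥ u = ε • u := by
    rw [regGram_mulVec] at hu ⊢
    rw [zero_smul, add_zero] at hu
    rw [hu, zero_add]
  obtain ⟨j, hj⟩ := Function.ne_iff.1 hu0
  have hpos : 0 < ∑ j, u j ^ 2 :=
    Finset.sum_pos' (fun _ _ => sq_nonneg _) ⟨j, Finset.mem_univ j, by
      have : u j ≠ 0 := hj
      positivity⟩
  have hk : ∀ k, u k ^ 2 ≤ ε * (regGram ε X)⁻¹ k k * ∑ j, u j ^ 2 := by
    intro k
    have h := regGram_inv_apply_self ε X k hunit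
    set v := (regGram ε X)⁻¹ *ᵥ Pi.single k 1 with hv
    have h1 : u k = ε * (v ⬝ᵥ u) := by
      have : v ⬝ᵥ regGram ε X *ᵥ u = u k := by
        rw [dotProduct_mulVec, ← mulVec_transpose, regGram_isSymm, hv, mulVec_mulVec,
          mul_nonsing_inv _ hunit, one_mulVec]
        simp
      rw [← this, hSu, dotProduct_smul, smul_eq_mul]
    have h2 : (v ⬝ᵥ u) ^ 2 ≤ (∑ j, v j ^ 2) * ∑ j, u j ^ 2 :=
      Finset.sum_mul_sq_le_sq_mul_sq _ _ _
    have h3 : ε * ∑ j, v j ^ 2 ≤ (regGram ε X)⁻¹ k k := by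
      rw [h]
      exact le_add_of_nonneg_left (Finset.sum_nonneg fun _ _ => sq_nonneg _)
    calc u k ^ 2 = ε ^ 2 * (v ⬝ᵥ u) ^ 2 := by rw [h1]; ring
      _ ≤ ε ^ 2 * ((∑ j, v j ^ 2) * ∑ j, u j ^ 2) := by gcongr
      _ = ε * (ε * ∑ j, v j ^ 2) * ∑ j, u j ^ 2 := by ring
      _ ≤ _ := by gcongr
  have hsum := Finset.sum_le_sum fun k (_ : k ∈ univ) => hk k
  rw [← Finset.sum_mul, ← Finset.mul_sum] at hsum
  exact le_of_mul_le_mul_right (by linarith) hpos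

/-- Splitting off the `k`-th coordinate of every sample. -/
lemma measurePreserving_splitCoord (n d : ℕ) (k : Fin (d + 1)) :
    MeasurePreserving
      (fun X : Fin n → Fin (d + 1) → ℝ => ((fun t => X t k), fun t j => X t (k.succAbove j)))
      (Measure.pi fun _ => stdGaussianPi (d + 1))
      ((stdGaussianPi n).prod (Measure.pi fun _ => stdGaussianPi d)) := by
  have h1 : MeasurePreserving (fun x : Fin (d + 1) → ℝ => (x k, fun j => x (k.succAbove j)))
      (stdGaussianPi (d + 1)) ((gaussianReal 0 1).prod (stdGaussianPi d)) :=
    measurePreserving_piFinSuccAbove (fun _ : Fin (d + 1) => gaussianReal 0 1) k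
  have h2 := measurePreserving_pi (fun _ : Fin n => stdGaussianPi (d + 1)) _ fun _ => h1
  exact (measurePreserving_arrowProdEquivProdArrow ℝ (Fin d → ℝ) (Fin n)
    (fun _ => gaussianReal 0 1) (fun _ => stdGaussianPi d)).comp h2

lemma integrable_sq_apply_stdGaussianPi {n d : ℕ} (t : Fin n) (j : Fin d) :
    Integrable (fun X : Fin n → Fin d → ℝ => X t j ^ 2) (Measure.pi fun _ => stdGaussianPi d) := by
  have h1 : Integrable (fun x : Fin d → ℝ => x j ^ 2) (stdGaussianPi d) :=
    integrable_comp_eval (μ := fun _ : Fin d => gaussianReal 0 1) (i := j)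
      (f := fun x : ℝ => x ^ 2) (memLp_id_gaussianReal 2).integrable_sq
  exact integrable_comp_eval (μ := fun _ : Fin n => stdGaussianPi d) (i := t) h1

lemma integral_sq_apply_stdGaussianPi {n d : ℕ} (t : Fin n) (j : Fin d) :
    ∫ X : Fin n → Fin d → ℝ, X t j ^ 2 ∂(Measure.pi fun _ => stdGaussianPi d) = 1 := by
  rw [integral_comp_eval (μ := fun _ : Fin n => stdGaussianPi d) (i := t)
    (f := fun x : Fin d → ℝ => x j ^ 2) (Measurable.aestronglyMeasurable (by fun_prop)),
    stdGaussianPi,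
    integral_comp_eval (μ := fun _ : Fin d => gaussianReal 0 1) (i := j)
    (f := fun x : ℝ => x ^ 2) (by fun_prop)]
  have h := variance_fun_id_gaussianReal (μ := 0) (v := 1)
  rw [variance_eq_integral (by fun_prop)] at h
  simpa using h

lemma lintegral_row_le {n d : ℕ} (hn : d + 3 ≤ n) {ε : ℝ} (hε : 0 ≤ ε) (k : Fin (d + 1))
    (B : Fin n → Fin d → ℝ) :
    ∫⁻ r : Fin n → ℝ, ENNReal.ofReal
      ((regGram ε fun t => (k.insertNth (r t) (B t) : Fin (d + 1) → ℝ))⁻¹ k k *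
        (1 + ∑ t, r t ^ 2)) ∂stdGaussianPi n ≤
      ∫⁻ g, ENNReal.ofReal (rowWeight n g) ∂stdGaussianPi n := by
  obtain ⟨b, hb⟩ := exists_orthonormalBasis_orthogonal hn fun j => WithLp.toLp 2 fun t => B t j
  have hmp := measurePreserving_repr_stdGaussianPi b
  have hmeas : AEMeasurable (fun g => ENNReal.ofReal (rowWeight n g)) (stdGaussianPi n) :=
    (integrable_rowWeight n).aemeasurable.ennreal_ofReal
  rw [← hmp.map_eq] at hmeas
  conv_rhs => rw [← hmp.map_eq, lintegral_map' hmeas hmp.aemeasurable]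
  refine lintegral_mono_ae ?_
  filter_upwards [hmp.quasiMeasurePreserving.ae (ae_ne_zero_stdGaussianPi n)] with r hr
  refine ENNReal.ofReal_le_ofReal ?_
  have hnorm : ∑ t, r t ^ 2 = ∑ i, (b.repr (WithLp.toLp 2 r) i) ^ 2 := by
    rw [← EuclideanSpace.real_norm_sq_eq (b.repr (WithLp.toLp 2 r)), b.repr.norm_map,
      EuclideanSpace.real_norm_sq_eq]
  rw [hnorm]
  refine mul_one_add_sum_le_rowWeight (by omega) hr ?_
  have := regGram_inv_mul_le_one hε (fun t => (k.insertNth (r t) (B t) : Fin (d + 1) → ℝ)) k b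
    (univ.filter fun i : Fin n => (i : ℕ) < 3) (fun i hi j hj => by
      obtain ⟨j', rfl⟩ := Fin.exists_succAbove_eq hj
      simpa using hb i (by simpa using hi) j')
  simpa using this

lemma measurable_regGram_inv_apply_mul {n d : ℕ} (ε : ℝ) (k : Fin d) :
    Measurable fun X : Fin n → Fin d → ℝ =>
      (regGram ε X)⁻¹ k k * (1 + ∑ t, ∑ j, X t j ^ 2) := by
  refine (measurable_matrix_inv_apply (fun i j => measurable_regGram_apply ε i j) k k).mul ?_
  fun_prop

lemma exists_lintegral_regGram_inv_le {n d : ℕ} (hn : d + 3 ≤ n) :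
    ∃ c : ENNReal, c ≠ ⊤ ∧ ∀ ε : ℝ, 0 ≤ ε → ∀ k : Fin (d + 1),
      ∫⁻ X : Fin n → Fin (d + 1) → ℝ, ENNReal.ofReal
        ((regGram ε X)⁻¹ k k * (1 + ∑ t, ∑ j, X t j ^ 2))
        ∂(Measure.pi fun _ => stdGaussianPi (d + 1)) ≤ c := by
  refine ⟨(∫⁻ g, ENNReal.ofReal (rowWeight n g) ∂stdGaussianPi n) *
    ∫⁻ B : Fin n → Fin d → ℝ, ENNReal.ofReal (1 + ∑ t, ∑ j, B t j ^ 2)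
      ∂(Measure.pi fun _ => stdGaussianPi d), ?_, fun ε hε k => ?_⟩
  · refine ENNReal.mul_ne_top (integrable_rowWeight n).lintegral_lt_top.ne ?_
    refine Integrable.lintegral_lt_top (Integrable.add (integrable_const 1) ?_) |>.ne
    exact integrable_finsetSum _ fun t _ => integrable_finsetSum _ fun j _ =>
      integrable_sq_apply_stdGaussianPi t j
  let J : (Fin n → ℝ) × (Fin n → Fin d → ℝ) → Fin n → Fin (d + 1) → ℝ :=
    fun z t => k.insertNth (z.1 t) (z.2 t)
  have hJ : Measurable J := by
    refine measurable_pi_iff.2 fun t => measurable_pi_iff.2 fun j => ?_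
    rcases Fin.eq_self_or_eq_succAbove k j with rfl | ⟨j', rfl⟩
    · simp only [J, Fin.insertNth_apply_same]
      fun_prop
    · simp only [J, Fin.insertNth_apply_succAbove]
      fun_prop
  let G : (Fin n → ℝ) × (Fin n → Fin d → ℝ) → ENNReal := fun z => ENNReal.ofReal
    ((regGram ε (J z))⁻¹ k k * (1 + ∑ t, ∑ j, J z t j ^ 2))
  have hGm : Measurable G := ((measurable_regGram_inv_apply_mul ε k).comp hJ).ennreal_ofReal
  have hmp := measurePreserving_splitCoord n d k
  have heq : ∀ X : Fin n → Fin (d + 1) → ℝ,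
      J ((fun t => X t k), fun t j => X t (k.succAbove j)) = X := by
    intro X
    funext t
    exact Fin.insertNth_self_removeNth k (X t)
  calc _ = ∫⁻ X : Fin n → Fin (d + 1) → ℝ, G ((fun t => X t k), fun t j => X t (k.succAbove j))
        ∂(Measure.pi fun _ => stdGaussianPi (d + 1)) := by simp only [G, heq]
    _ = ∫⁻ z, G z ∂((stdGaussianPi n).prod (Measure.pi fun _ => stdGaussianPi d)) :=
        hmp.lintegral_comp hGm
    _ = ∫⁻ B, ∫⁻ r, G (r, B) ∂stdGaussianPi n ∂(Measure.pi fun _ => stdGaussianPi d) :=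
        lintegral_prod_symm' _ hGm
    _ ≤ ∫⁻ B : Fin n → Fin d → ℝ, (∫⁻ g, ENNReal.ofReal (rowWeight n g) ∂stdGaussianPi n) *
          ENNReal.ofReal (1 + ∑ t, ∑ j, B t j ^ 2) ∂(Measure.pi fun _ => stdGaussianPi d) := by
        refine lintegral_mono fun B => ?_
        refine le_trans ?_ (mul_le_mul_left (lintegral_row_le hn hε k B) _)
        rw [← lintegral_mul_const' _ _ ENNReal.ofReal_ne_top]
        refine lintegral_mono fun r => ?_
        have hnn := regGram_inv_apply_self_nonneg hε
          (fun t => (k.insertNth (r t) (B t) : Fin (d + 1) → ℝ)) k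
        rw [← ENNReal.ofReal_mul (by positivity)]
        refine ENNReal.ofReal_le_ofReal ?_
        rw [mul_assoc]
        refine mul_le_mul_of_nonneg_left ?_ hnn
        have : ∑ t, ∑ j, J (r, B) t j ^ 2 = ∑ t, r t ^ 2 + ∑ t, ∑ j, B t j ^ 2 := by
          rw [← Finset.sum_add_distrib]
          refine Finset.sum_congr rfl fun t _ => ?_
          rw [Fin.sum_univ_succAbove _ k]
          simp [J]
        rw [this]
        have h1 : 0 ≤ ∑ t, r t ^ 2 := by positivity
        have h2 : 0 ≤ ∑ t, ∑ j, B t j ^ 2 := by positivity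
        nlinarith [mul_nonneg h1 h2]
    _ = _ := by
        rw [lintegral_const_mul _ (by fun_prop)]

end InverseGram

section GaussianDesign

/-- The law of `n` independent standard Gaussian covariate vectors in `ℝ^d`. -/
abbrev stdDesign (n d : ℕ) : Measure (Fin n → Fin d → ℝ) :=
  Measure.pi fun _ => stdGaussianPi d

lemma ae_isUnit_det_regGram_zero {n d : ℕ} (hn : d + 2 ≤ n) :
    ∀ᵐ X ∂stdDesign n d, IsUnit (regGram 0 X).det := by
  cases d with
  | zero => exact Filter.Eventually.of_forall fun X => by simp
  | succ d =>
    obtain ⟨c, hc, hle⟩ := exists_lintegral_regGram_inv_le (n := n) (d := d) (by omega)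
    have hbound : ∀ m : ℕ, stdDesign n (d + 1) {X | (regGram 0 X).det = 0} ≤
        ((d + 1) * c) / ((m + 1 : ℕ) : ENNReal) := by
      intro m
      have hm : (0 : ℝ) < ((m + 1 : ℕ) : ℝ) := by positivity
      have hmeas : ∀ k, Measurable fun X : Fin n → Fin (d + 1) → ℝ => ENNReal.ofReal
          ((regGram (((m + 1 : ℕ) : ℝ)⁻¹) X)⁻¹ k k * (1 + ∑ t, ∑ j, X t j ^ 2)) := by
        exact fun k => (measurable_regGram_inv_apply_mul _ k).ennreal_ofReal
      have h1 : ∀ X ∈ {X : Fin n → Fin (d + 1) → ℝ | (regGram 0 X).det = 0},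
          ((m + 1 : ℕ) : ENNReal) ≤ ∑ k, ENNReal.ofReal
            ((regGram (((m + 1 : ℕ) : ℝ)⁻¹) X)⁻¹ k k * (1 + ∑ t, ∑ j, X t j ^ 2)) := by
        intro X hX
        have h2 := one_le_mul_trace_regGram_inv (inv_pos.2 hm) X hX
        rw [inv_mul_eq_div, one_le_div hm] at h2
        have hnn := fun k => regGram_inv_apply_self_nonneg (inv_pos.2 hm).le X k
        have h3 : 0 ≤ ∑ t, ∑ j, X t j ^ 2 := by positivity
        rw [← ENNReal.ofReal_sum_of_nonneg fun k _ => mul_nonneg (hnn k) (by positivity),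
          ← ENNReal.ofReal_natCast]
        refine ENNReal.ofReal_le_ofReal (h2.trans (Finset.sum_le_sum fun k _ => ?_))
        exact le_mul_of_one_le_right (hnn k) (by linarith)
      rw [ENNReal.le_div_iff_mul_le (by simp) (by simp), mul_comm]
      calc _ ≤ ((m + 1 : ℕ) : ENNReal) * stdDesign n (d + 1) {X | ((m + 1 : ℕ) : ENNReal) ≤
              ∑ k, ENNReal.ofReal
                ((regGram (((m + 1 : ℕ) : ℝ)⁻¹) X)⁻¹ k k * (1 + ∑ t, ∑ j, X t j ^ 2))} := by
            exact mul_le_mul' le_rfl (measure_mono h1)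
        _ ≤ ∫⁻ X, ∑ k, ENNReal.ofReal ((regGram (((m + 1 : ℕ) : ℝ)⁻¹) X)⁻¹ k k *
              (1 + ∑ t, ∑ j, X t j ^ 2)) ∂stdDesign n (d + 1) :=
            mul_meas_ge_le_lintegral (Finset.measurable_sum _ fun k _ => hmeas k) _
        _ ≤ (d + 1) * c := by
            rw [lintegral_finsetSum _ fun k _ => hmeas k]
            refine (Finset.sum_le_sum fun k _ => hle _ (inv_pos.2 hm).le k).trans ?_
            simp
    have hzero : stdDesign n (d + 1) {X | (regGram 0 X).det = 0} = 0 := by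
      have hlim : Filter.Tendsto (fun m : ℕ => ((d + 1) * c) / ((m + 1 : ℕ) : ENNReal))
          Filter.atTop (nhds 0) := by
        have := ENNReal.Tendsto.const_div (a := (d + 1) * c)
          (ENNReal.tendsto_nat_nhds_top.comp (Filter.tendsto_add_atTop_nat 1))
          (Or.inr (ENNReal.mul_ne_top (by simp) hc))
        simpa using this
      exact le_antisymm (ge_of_tendsto' hlim hbound) bot_le
    simpa [ae_iff] using hzero

lemma integrable_trace_regGram_inv_mul {n d : ℕ} (hn : d + 2 ≤ n) :
    Integrable (fun X => (regGram 0 X)⁻¹.trace * (1 + ∑ t, ∑ j, X t j ^ 2)) (stdDesign n d) := by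
  cases d with
  | zero => simp [Matrix.trace]
  | succ d =>
    obtain ⟨c, hc, hle⟩ := exists_lintegral_regGram_inv_le (n := n) (d := d) (by omega)
    simp only [Matrix.trace, Matrix.diag, Finset.sum_mul]
    refine integrable_finsetSum _ fun k _ => ⟨?_, ?_⟩
    · exact (measurable_regGram_inv_apply_mul 0 k).aestronglyMeasurable
    · rw [hasFiniteIntegral_iff_ofReal (Filter.Eventually.of_forall fun X => mul_nonneg
        (regGram_inv_apply_self_nonneg le_rfl X k) (by positivity))]
      exact (hle 0 le_rfl k).trans_lt hc.lt_top

/-- The entries `⟨S⁻¹ x_t, S⁻¹ x_u⟩` of the kernel through which the excess risk of a least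
squares estimator depends on the residuals. -/
def olsKernel {n d : ℕ} (X : Fin n → Fin d → ℝ) (t u : Fin n) : ℝ :=
  ((regGram 0 X)⁻¹ *ᵥ X t) ⬝ᵥ ((regGram 0 X)⁻¹ *ᵥ X u)

lemma measurable_regGram_inv_mulVec_apply {n d : ℕ} (t : Fin n) (j : Fin d) :
    Measurable fun X : Fin n → Fin d → ℝ => ((regGram 0 X)⁻¹ *ᵥ X t) j := by
  simp only [mulVec, dotProduct]
  refine Finset.measurable_sum _ fun k _ => Measurable.mul ?_ (by fun_prop)
  exact measurable_matrix_inv_apply (fun i j => measurable_regGram_apply 0 i j) j k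

lemma measurable_olsKernel {n d : ℕ} (t u : Fin n) :
    Measurable fun X : Fin n → Fin d → ℝ => olsKernel X t u := by
  simp only [olsKernel, dotProduct]
  exact Finset.measurable_sum _ fun k _ => (measurable_regGram_inv_mulVec_apply t k).mul
    (measurable_regGram_inv_mulVec_apply u k)

lemma regGram_inv_mulVec_apply {n d : ℕ} (X : Fin n → Fin d → ℝ) (x : Fin d → ℝ) (k : Fin d) :
    ((regGram 0 X)⁻¹ *ᵥ x) k = x ⬝ᵥ (regGram 0 X)⁻¹ *ᵥ Pi.single k 1 := by
  rw [dotProduct_mulVec, ← mulVec_transpose, transpose_nonsing_inv, regGram_isSymm]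
  simp

lemma sum_olsKernel_self {n d : ℕ} (X : Fin n → Fin d → ℝ) :
    ∑ t, olsKernel X t t = (regGram 0 X)⁻¹.trace := by
  by_cases hdet : IsUnit (regGram 0 X).det
  · simp only [olsKernel, Matrix.trace, Matrix.diag, dotProduct]
    rw [Finset.sum_comm]
    refine Finset.sum_congr rfl fun k _ => ?_
    rw [regGram_inv_apply_self 0 X k hdet, zero_mul, add_zero]
    refine Finset.sum_congr rfl fun t _ => ?_
    rw [regGram_inv_mulVec_apply, sq]
  · simp [olsKernel, nonsing_inv_apply_not_isUnit _ hdet]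

lemma olsKernel_self_nonneg {n d : ℕ} (X : Fin n → Fin d → ℝ) (t : Fin n) :
    0 ≤ olsKernel X t t := by
  simp only [olsKernel, dotProduct]
  exact Finset.sum_nonneg fun _ _ => mul_self_nonneg _

lemma olsKernel_self_le_trace {n d : ℕ} (X : Fin n → Fin d → ℝ) (t : Fin n) :
    olsKernel X t t ≤ (regGram 0 X)⁻¹.trace := by
  rw [← sum_olsKernel_self]
  exact Finset.single_le_sum (f := fun t => olsKernel X t t)
    (fun t _ => olsKernel_self_nonneg X t) (Finset.mem_univ t)

lemma abs_dotProduct_le_half {d : ℕ} (v w : Fin d → ℝ) :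
    |v ⬝ᵥ w| ≤ (v ⬝ᵥ v + w ⬝ᵥ w) / 2 := by
  have h1 : 0 ≤ (v - w) ⬝ᵥ (v - w) := Finset.sum_nonneg fun _ _ => mul_self_nonneg _
  have h2 : 0 ≤ (v + w) ⬝ᵥ (v + w) := Finset.sum_nonneg fun _ _ => mul_self_nonneg _
  simp only [sub_dotProduct, dotProduct_sub, add_dotProduct, dotProduct_add,
    dotProduct_comm w v] at h1 h2
  rw [abs_le]
  constructor <;> linarith

lemma abs_olsKernel_mul_le {n d : ℕ} (X : Fin n → Fin d → ℝ) (t u : Fin n) (a b : ℝ) :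
    |olsKernel X t u * (a * b)| ≤ (olsKernel X t t * a ^ 2 + olsKernel X u u * b ^ 2) / 2 := by
  have h := abs_dotProduct_le_half (a • ((regGram 0 X)⁻¹ *ᵥ X t)) (b • ((regGram 0 X)⁻¹ *ᵥ X u))
  simp only [smul_dotProduct, dotProduct_smul, smul_eq_mul] at h
  simp only [olsKernel]
  convert h using 2 <;> ring

lemma integrable_olsKernel_mul {n d : ℕ} (hn : d + 2 ≤ n) (t u : Fin n)
    {a b : (Fin n → Fin d → ℝ) → ℝ} (ha : Measurable a) (hb : Measurable b) (κ : ℝ)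
    (hale : ∀ X, a X ^ 2 ≤ κ * (1 + ∑ t, ∑ j, X t j ^ 2))
    (hble : ∀ X, b X ^ 2 ≤ κ * (1 + ∑ t, ∑ j, X t j ^ 2)) :
    Integrable (fun X => olsKernel X t u * (a X * b X)) (stdDesign n d) := by
  refine ((integrable_trace_regGram_inv_mul hn).const_mul κ).mono'
    ((measurable_olsKernel t u).mul (ha.mul hb)).aestronglyMeasurable
    (Filter.Eventually.of_forall fun X => ?_)
  rw [Real.norm_eq_abs]
  refine (abs_olsKernel_mul_le X t u (a X) (b X)).trans ?_
  have ht : olsKernel X t t * a X ^ 2 ≤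
      (regGram 0 X)⁻¹.trace * (κ * (1 + ∑ t, ∑ j, X t j ^ 2)) :=
    mul_le_mul (olsKernel_self_le_trace X t) (hale X) (sq_nonneg _)
      ((olsKernel_self_nonneg X t).trans (olsKernel_self_le_trace X t))
  have hu : olsKernel X u u * b X ^ 2 ≤
      (regGram 0 X)⁻¹.trace * (κ * (1 + ∑ t, ∑ j, X t j ^ 2)) :=
    mul_le_mul (olsKernel_self_le_trace X u) (hble X) (sq_nonneg _)
      ((olsKernel_self_nonneg X u).trans (olsKernel_self_le_trace X u))
  linarith

lemma sq_dotProduct_le {n d : ℕ} (φ : Fin d → ℝ) (X : Fin n → Fin d → ℝ) (t : Fin n) :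
    (φ ⬝ᵥ X t) ^ 2 ≤ (1 + φ ⬝ᵥ φ) * (1 + ∑ t, ∑ j, X t j ^ 2) := by
  have h1 : (φ ⬝ᵥ X t) ^ 2 ≤ (∑ j, φ j ^ 2) * ∑ j, X t j ^ 2 :=
    Finset.sum_mul_sq_le_sq_mul_sq _ _ _
  have h2 : φ ⬝ᵥ φ = ∑ j, φ j ^ 2 := by simp [dotProduct, sq]
  have h3 : ∑ j, X t j ^ 2 ≤ ∑ t, ∑ j, X t j ^ 2 :=
    Finset.single_le_sum (f := fun t => ∑ j, X t j ^ 2)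
      (fun t _ => Finset.sum_nonneg fun _ _ => sq_nonneg _) (Finset.mem_univ t)
  have h4 : 0 ≤ ∑ j, φ j ^ 2 := by positivity
  have h5 : 0 ≤ ∑ t, ∑ j, X t j ^ 2 := by positivity
  rw [h2]
  nlinarith [mul_le_mul_of_nonneg_left h3 h4]

lemma one_sq_le_weight {n d : ℕ} (φ : Fin d → ℝ) (X : Fin n → Fin d → ℝ) :
    (1 : ℝ) ^ 2 ≤ (1 + φ ⬝ᵥ φ) * (1 + ∑ t, ∑ j, X t j ^ 2) := by
  have h4 : 0 ≤ φ ⬝ᵥ φ := Finset.sum_nonneg fun _ _ => mul_self_nonneg _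
  have h5 : 0 ≤ ∑ t, ∑ j, X t j ^ 2 := by positivity
  nlinarith [mul_nonneg h4 h5]

lemma measurable_dotProduct_apply {n d : ℕ} (φ : Fin d → ℝ) (t : Fin n) :
    Measurable fun X : Fin n → Fin d → ℝ => φ ⬝ᵥ X t := by
  simp only [dotProduct]
  fun_prop

lemma integrable_olsKernel {n d : ℕ} (hn : d + 2 ≤ n) (t u : Fin n) :
    Integrable (fun X => olsKernel X t u) (stdDesign n d) := by
  simpa using integrable_olsKernel_mul hn t u (a := fun _ => 1) (b := fun _ => 1)
    measurable_const measurable_const _ (one_sq_le_weight 0) (one_sq_le_weight 0)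

lemma integrable_dotProduct_regGram_inv_mulVec {n d : ℕ} (hn : d + 2 ≤ n) (φ : Fin d → ℝ)
    (t : Fin n) :
    Integrable (fun X => φ ⬝ᵥ (regGram 0 X)⁻¹ *ᵥ X t) (stdDesign n d) := by
  refine (((integrable_const (φ ⬝ᵥ φ)).add (integrable_olsKernel hn t t)).div_const 2).mono'
    ?_ (Filter.Eventually.of_forall fun X => abs_dotProduct_le_half φ _)
  refine Measurable.aestronglyMeasurable ?_
  simp only [dotProduct]
  exact Finset.measurable_sum _ fun k _ => (measurable_regGram_inv_mulVec_apply t k).const_mul _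

lemma integrable_trace_regGram_inv {n d : ℕ} (hn : d + 2 ≤ n) :
    Integrable (fun X => (regGram 0 X)⁻¹.trace) (stdDesign n d) := by
  simp only [← sum_olsKernel_self]
  exact integrable_finsetSum _ fun t _ => integrable_olsKernel hn t t

lemma two_mul_sub_le_regGram_inv_apply_self {n d : ℕ} (X : Fin n → Fin d → ℝ)
    (hdet : IsUnit (regGram 0 X).det) (c : ℝ) (k : Fin d) :
    2 * c - c ^ 2 * ∑ t, X t k ^ 2 ≤ (regGram 0 X)⁻¹ k k := by
  have h := dotProduct_regGram_mulVec 0 X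
    ((regGram 0 X)⁻¹ *ᵥ Pi.single k 1 - c • Pi.single k 1)
  rw [zero_mul, add_zero] at h
  have h0 : 0 ≤ ∑ t, (X t ⬝ᵥ ((regGram 0 X)⁻¹ *ᵥ Pi.single k 1 - c • Pi.single k 1)) ^ 2 :=
    Finset.sum_nonneg fun _ _ => sq_nonneg _
  rw [← h, mulVec_sub, mulVec_mulVec, mul_nonsing_inv _ hdet, one_mulVec, mulVec_smul] at h0
  have h1 : ((regGram 0 X)⁻¹ *ᵥ Pi.single k 1) ⬝ᵥ (regGram 0 X *ᵥ Pi.single k 1) = 1 := by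
    rw [dotProduct_mulVec, ← mulVec_transpose, regGram_isSymm, mulVec_mulVec,
      mul_nonsing_inv _ hdet, one_mulVec]
    simp
  have h2 : (Pi.single k 1 : Fin d → ℝ) ⬝ᵥ (regGram 0 X *ᵥ Pi.single k 1) = ∑ t, X t k ^ 2 := by
    rw [dotProduct_regGram_mulVec]
    simp
  simp only [sub_dotProduct, dotProduct_sub, smul_dotProduct, dotProduct_smul, h1, h2] at h0
  simp at h0
  nlinarith

lemma div_le_integral_trace_regGram_inv {n d : ℕ} (hn : d + 2 ≤ n) :
    (d : ℝ) / n ≤ ∫ X, (regGram 0 X)⁻¹.trace ∂stdDesign n d := by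
  have hn0 : (0 : ℝ) < n := by
    have : 0 < n := by omega
    exact_mod_cast this
  have hsq : Integrable (fun X : Fin n → Fin d → ℝ => ∑ k, ∑ t, X t k ^ 2) (stdDesign n d) :=
    integrable_finsetSum _ fun k _ => integrable_finsetSum _ fun t _ =>
      integrable_sq_apply_stdGaussianPi t k
  have hval : ∫ X : Fin n → Fin d → ℝ, ∑ k, ∑ t, X t k ^ 2 ∂stdDesign n d = d * n := by
    rw [integral_finsetSum _ fun k _ => integrable_finsetSum _ fun t _ =>
      integrable_sq_apply_stdGaussianPi t k]
    simp_rw [integral_finsetSum univ fun t _ => integrable_sq_apply_stdGaussianPi t _,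
      integral_sq_apply_stdGaussianPi]
    simp
  have hle : ∫ X : Fin n → Fin d → ℝ, (2 * (n : ℝ)⁻¹ * d - (n : ℝ)⁻¹ ^ 2 * ∑ k, ∑ t, X t k ^ 2)
      ∂stdDesign n d ≤ ∫ X, (regGram 0 X)⁻¹.trace ∂stdDesign n d := by
    refine integral_mono_ae ((integrable_const _).sub (hsq.const_mul _))
      (integrable_trace_regGram_inv hn) ?_
    filter_upwards [ae_isUnit_det_regGram_zero hn] with X hX
    have := Finset.sum_le_sum fun k (_ : k ∈ univ) =>
      two_mul_sub_le_regGram_inv_apply_self X hX (n : ℝ)⁻¹ k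
    rw [Finset.sum_sub_distrib, ← Finset.mul_sum (f := fun k => ∑ t, X t k ^ 2)] at this
    simp only [Finset.sum_const, Finset.card_univ, Fintype.card_fin, nsmul_eq_mul] at this
    simp only [Matrix.trace, Matrix.diag]
    linarith
  rw [integral_sub (integrable_const _) (hsq.const_mul _), integral_const,
    integral_const_mul, hval] at hle
  refine le_trans (le_of_eq ?_) hle
  simp
  field_simp
  ring

end GaussianDesign

section Expectation

/-- `F` is integrable with integral `v`. -/
def HasExpectation {α : Type*} [MeasurableSpace α] (μ : Measure α) (F : α → ℝ) (v : ℝ) : Prop :=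
  Integrable F μ ∧ ∫ x, F x ∂μ = v

namespace HasExpectation

variable {α β : Type*} [MeasurableSpace α] [MeasurableSpace β] {μ : Measure α} {ν : Measure β}
  {F G : α → ℝ} {v w : ℝ}

lemma add (hF : HasExpectation μ F v) (hG : HasExpectation μ G w) :
    HasExpectation μ (fun x => F x + G x) (v + w) :=
  ⟨hF.1.add hG.1, by rw [integral_add hF.1 hG.1, hF.2, hG.2]⟩

lemma const_mul (hF : HasExpectation μ F v) (c : ℝ) :
    HasExpectation μ (fun x => c * F x) (c * v) :=
  ⟨hF.1.const_mul c, by rw [integral_const_mul, hF.2]⟩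

lemma sum {ι : Type*} (s : Finset ι) {F : ι → α → ℝ} {v : ι → ℝ}
    (hF : ∀ i, HasExpectation μ (F i) (v i)) :
    HasExpectation μ (fun x => ∑ i ∈ s, F i x) (∑ i ∈ s, v i) :=
  ⟨integrable_finsetSum _ fun i _ => (hF i).1, by
    rw [integral_finsetSum _ fun i _ => (hF i).1]
    exact Finset.sum_congr rfl fun i _ => (hF i).2⟩

lemma const [IsProbabilityMeasure μ] (c : ℝ) : HasExpectation μ (fun _ => c) c :=
  ⟨integrable_const c, by simp⟩

lemma congr (hF : HasExpectation μ F v) (h : ∀ᵐ x ∂μ, G x = F x) (hvw : w = v) :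
    HasExpectation μ G w := by
  subst hvw
  exact ⟨hF.1.congr (h.mono fun x hx => hx.symm), (integral_congr_ae h).trans hF.2⟩

lemma mul_prod [SFinite μ] [SFinite ν] {f : α → ℝ} {g : β → ℝ} (hf : HasExpectation μ f v)
    (hg : HasExpectation ν g w) :
    HasExpectation (μ.prod ν) (fun z => f z.1 * g z.2) (v * w) :=
  ⟨hf.1.mul_prod hg.1, by rw [integral_prod_mul, hf.2, hg.2]⟩

lemma pi_eval {n : ℕ} [IsProbabilityMeasure μ] (hF : HasExpectation μ F v) (t : Fin n) :
    HasExpectation (Measure.pi fun _ : Fin n => μ) (fun x => F (x t)) v :=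
  ⟨integrable_comp_eval (μ := fun _ : Fin n => μ) hF.1, by
    rw [integral_comp_eval (μ := fun _ : Fin n => μ) hF.1.aestronglyMeasurable, hF.2]⟩

lemma pi_eval_mul {n : ℕ} [IsProbabilityMeasure μ] {u : ℝ} (hFm : AEMeasurable F μ)
    (hF : HasExpectation μ F v) (hFF : HasExpectation μ (fun x => F x ^ 2) w) (hu : v ^ 2 = u)
    (t t' : Fin n) :
    HasExpectation (Measure.pi fun _ : Fin n => μ) (fun x => F (x t) * F (x t'))
      (if t = t' then w else u) := by
  split_ifs with h
  · subst h
    exact (hFF.pi_eval t).congr (Filter.Eventually.of_forall fun x => by ring) rfl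
  · have hind := (iIndepFun_pi (μ := fun _ : Fin n => μ) (X := fun _ => F) fun _ => hFm).indepFun h
    have h1 := hF.pi_eval t
    have h2 := hF.pi_eval t'
    refine ⟨hind.integrable_mul h1.1 h2.1, ?_⟩
    rw [hind.integral_fun_mul_eq_mul_integral h1.1.aestronglyMeasurable h2.1.aestronglyMeasurable,
      h1.2, h2.2, ← hu, sq]

end HasExpectation

end Expectation

section Noise

variable {n : ℕ}

lemma hasExpectation_sq_noise {ν : Measure ℝ} {τ : ℝ} (hτ : 0 < τ) (h : ∫ e, e ^ 2 ∂ν = τ) :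
    HasExpectation ν (fun e => e ^ 2) τ :=
  ⟨Integrable.of_integral_ne_zero (by rw [h]; exact hτ.ne'), h⟩

lemma hasExpectation_noise {ν : Measure ℝ} [IsProbabilityMeasure ν] {τ : ℝ} (hτ : 0 < τ)
    (h0 : ∫ e, e ∂ν = 0) (h : ∫ e, e ^ 2 ∂ν = τ) : HasExpectation ν (fun e => e) 0 := by
  refine ⟨?_, h0⟩
  have h2 : MemLp (fun e : ℝ => e) 2 ν :=
    (memLp_two_iff_integrable_sq measurable_id.aestronglyMeasurable).2
      (hasExpectation_sq_noise hτ h).1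
  exact h2.integrable (by norm_num)

lemma hasExpectation_noise_mul {ν : Measure ℝ} [IsProbabilityMeasure ν] {τ : ℝ} (hτ : 0 < τ)
    (h0 : ∫ e, e ∂ν = 0) (h : ∫ e, e ^ 2 ∂ν = τ) (t u : Fin n) :
    HasExpectation (Measure.pi fun _ : Fin n => ν) (fun e => e t * e u)
      (if t = u then τ else 0) :=
  (hasExpectation_noise hτ h0 h).pi_eval_mul aemeasurable_id (hasExpectation_sq_noise hτ h)
    (by simp) t u

end Noise

section Proportions

variable {n K : ℕ} {ν : Measure (Fin K → ℝ)} [IsProbabilityMeasure ν] {i : Fin K} {p s M : ℝ}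

lemma hasExpectation_prop_sub (hM : ∀ᵐ v ∂ν, |v i| ≤ M) (hp : ∫ v, v i ∂ν = p) :
    HasExpectation ν (fun v => v i - p) 0 := by
  have hint : Integrable (fun v : Fin K → ℝ => v i) ν :=
    Integrable.of_bound (measurable_pi_apply i).aestronglyMeasurable M hM
  refine ⟨hint.sub (integrable_const p), ?_⟩
  rw [integral_sub hint (integrable_const p), hp]
  simp

lemma hasExpectation_prop_sub_sq (hM : ∀ᵐ v ∂ν, |v i| ≤ M)
    (hs : ∫ v, (v i - p) ^ 2 ∂ν = s) :
    HasExpectation ν (fun v => (v i - p) ^ 2) s := by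
  refine ⟨Integrable.of_bound (Measurable.aestronglyMeasurable (by fun_prop))
    ((M + |p|) ^ 2) ?_, hs⟩
  filter_upwards [hM] with v hv
  rw [Real.norm_eq_abs, abs_pow]
  gcongr
  exact (abs_sub _ _).trans (by gcongr)

lemma hasExpectation_prop_sub_mul (hM : ∀ᵐ v ∂ν, |v i| ≤ M) (hp : ∫ v, v i ∂ν = p)
    (hs : ∫ v, (v i - p) ^ 2 ∂ν = s) (t u : Fin n) :
    HasExpectation (Measure.pi fun _ : Fin n => ν) (fun a => (a t i - p) * (a u i - p))
      (if t = u then s else 0) :=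
  (hasExpectation_prop_sub hM hp).pi_eval_mul (F := fun v : Fin K → ℝ => v i - p)
    (Measurable.aemeasurable (by fun_prop)) (hasExpectation_prop_sub_sq hM hs) (by simp) t u

lemma hasExpectation_prop_mul_sub (hM : ∀ᵐ v ∂ν, |v i| ≤ M) (hp : ∫ v, v i ∂ν = p)
    (hs : ∫ v, (v i - p) ^ 2 ∂ν = s) (t u : Fin n) :
    HasExpectation (Measure.pi fun _ : Fin n => ν) (fun a => a t i * (a u i - p))
      (if t = u then s else 0) := by
  refine ((hasExpectation_prop_sub_mul hM hp hs t u).add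
    (((hasExpectation_prop_sub hM hp).pi_eval u).const_mul p)).congr
    (Filter.Eventually.of_forall fun a => by ring) (by simp)

lemma hasExpectation_prop_mul (hM : ∀ᵐ v ∂ν, |v i| ≤ M) (hp : ∫ v, v i ∂ν = p)
    (hs : ∫ v, (v i - p) ^ 2 ∂ν = s) (t u : Fin n) :
    HasExpectation (Measure.pi fun _ : Fin n => ν) (fun a => a t i * a u i)
      (p ^ 2 + if t = u then s else 0) := by
  refine (((hasExpectation_prop_mul_sub hM hp hs t u).add
    (((hasExpectation_prop_sub hM hp).pi_eval t).const_mul p)).add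
    (HasExpectation.const (p ^ 2))).congr
    (Filter.Eventually.of_forall fun a => by ring) (by ring)

lemma hasExpectation_mean_sub (hn : n ≠ 0) (hM : ∀ᵐ v ∂ν, |v i| ≤ M) (hp : ∫ v, v i ∂ν = p) :
    HasExpectation (Measure.pi fun _ : Fin n => ν) (fun a => (∑ t, a t i) / n - p) 0 := by
  have hn' : (n : ℝ) ≠ 0 := by exact_mod_cast hn
  refine ((HasExpectation.sum univ fun t : Fin n =>
    (hasExpectation_prop_sub hM hp).pi_eval t).const_mul (n : ℝ)⁻¹).congr
    (Filter.Eventually.of_forall fun a => ?_) (by simp)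
  simp only [Finset.sum_sub_distrib, Finset.sum_const, Finset.card_univ, Fintype.card_fin,
    nsmul_eq_mul]
  field_simp

lemma hasExpectation_mean_sub_sq (hn : n ≠ 0) (hM : ∀ᵐ v ∂ν, |v i| ≤ M) (hp : ∫ v, v i ∂ν = p)
    (hs : ∫ v, (v i - p) ^ 2 ∂ν = s) :
    HasExpectation (Measure.pi fun _ : Fin n => ν) (fun a => ((∑ t, a t i) / n - p) ^ 2)
      (s / n) := by
  have hn' : (n : ℝ) ≠ 0 := by exact_mod_cast hn
  refine ((HasExpectation.sum univ fun t : Fin n => HasExpectation.sum univ fun u : Fin n =>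
    hasExpectation_prop_sub_mul hM hp hs t u).const_mul ((n : ℝ)⁻¹ ^ 2)).congr
    (Filter.Eventually.of_forall fun a => ?_) ?_
  · rw [← Finset.sum_mul_sum]
    simp only [Finset.sum_sub_distrib, Finset.sum_const, Finset.card_univ, Fintype.card_fin,
      nsmul_eq_mul]
    field_simp
  · simp
    field_simp

lemma hasExpectation_mean_mul_sub (hn : n ≠ 0) (hM : ∀ᵐ v ∂ν, |v i| ≤ M) (hp : ∫ v, v i ∂ν = p)
    (hs : ∫ v, (v i - p) ^ 2 ∂ν = s) :
    HasExpectation (Measure.pi fun _ : Fin n => ν)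
      (fun a => (∑ t, a t i) / n * ((∑ t, a t i) / n - p)) (s / n) :=
  ((hasExpectation_mean_sub_sq hn hM hp hs).add
    ((hasExpectation_mean_sub hn hM hp).const_mul p)).congr
    (Filter.Eventually.of_forall fun a => by ring) (by simp)

lemma hasExpectation_mean_sq (hn : n ≠ 0) (hM : ∀ᵐ v ∂ν, |v i| ≤ M) (hp : ∫ v, v i ∂ν = p)
    (hs : ∫ v, (v i - p) ^ 2 ∂ν = s) :
    HasExpectation (Measure.pi fun _ : Fin n => ν) (fun a => ((∑ t, a t i) / n) ^ 2)
      (p ^ 2 + s / n) :=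
  (((hasExpectation_mean_mul_sub hn hM hp hs).add
    ((hasExpectation_mean_sub hn hM hp).const_mul p)).add (HasExpectation.const (p ^ 2))).congr
    (Filter.Eventually.of_forall fun a => by ring) (by ring)

end Proportions

section StandardDesign

variable {d n K : ℕ}

lemma regGram_zero_eq_Smat (ω : HierOmega d n K) : regGram 0 ω.1 = Smat ω := by
  simp [regGram, Smat]

lemma dotProduct_self_sum_smul_regGram_inv (X : Fin n → Fin d → ℝ) (r : Fin n → ℝ) :
    (∑ t, r t • ((regGram 0 X)⁻¹ *ᵥ X t)) ⬝ᵥ (∑ t, r t • ((regGram 0 X)⁻¹ *ᵥ X t)) =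
      ∑ t, ∑ u, olsKernel X t u * (r t * r u) := by
  simp only [sum_dotProduct, dotProduct_sum, smul_dotProduct, dotProduct_smul, smul_eq_mul,
    olsKernel, Finset.mul_sum]
  rw [Finset.sum_comm]
  exact Finset.sum_congr rfl fun t _ => Finset.sum_congr rfl fun u _ => by ring

lemma regGram_inv_mulVec_sum (X : Fin n → Fin d → ℝ) (r : Fin n → ℝ) :
    (regGram 0 X)⁻¹ *ᵥ (∑ t, r t • X t) = ∑ t, r t • ((regGram 0 X)⁻¹ *ᵥ X t) := by
  simp only [mulVec_sum, mulVec_smul]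

lemma sum_dotProduct_smul_regGram_inv (X : Fin n → Fin d → ℝ) (hX : IsUnit (regGram 0 X).det)
    (φ : Fin d → ℝ) : ∑ t, (φ ⬝ᵥ X t) • ((regGram 0 X)⁻¹ *ᵥ X t) = φ := by
  have h := regGram_mulVec 0 X φ
  rw [zero_smul, add_zero] at h
  simp only [dotProduct_comm φ]
  rw [← regGram_inv_mulVec_sum, ← h, mulVec_mulVec, nonsing_inv_mul _ hX, one_mulVec]

lemma excessRisk_one (v w : Fin d → ℝ) : excessRisk 1 v w = (w - v) ⬝ᵥ (w - v) := by
  simp [excessRisk]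

lemma excessRisk_thetaBU_eq (φ : Fin d → ℝ) (p : ℝ) (i : Fin K) (ω : HierOmega d n K)
    (hω : IsUnit (regGram 0 ω.1).det) :
    excessRisk 1 (p • φ) (thetaBU φ i ω) = ∑ t, ∑ u, olsKernel ω.1 t u *
      ((ω.2.2 t i * ω.2.1 t + (ω.2.2 t i - p) * (φ ⬝ᵥ ω.1 t)) *
        (ω.2.2 u i * ω.2.1 u + (ω.2.2 u i - p) * (φ ⬝ᵥ ω.1 u))) := by
  rw [excessRisk_one, ← dotProduct_self_sum_smul_regGram_inv ω.1
    fun t => ω.2.2 t i * ω.2.1 t + (ω.2.2 t i - p) * (φ ⬝ᵥ ω.1 t)]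
  have h : thetaBU φ i ω - p • φ = ∑ t, (ω.2.2 t i * ω.2.1 t + (ω.2.2 t i - p) * (φ ⬝ᵥ ω.1 t)) •
      ((regGram 0 ω.1)⁻¹ *ᵥ ω.1 t) := by
    have hφ : p • φ = ∑ t, p • (φ ⬝ᵥ ω.1 t) • ((regGram 0 ω.1)⁻¹ *ᵥ ω.1 t) := by
      rw [← Finset.smul_sum, sum_dotProduct_smul_regGram_inv ω.1 hω φ]
    rw [hφ, thetaBU, ← regGram_zero_eq_Smat, regGram_inv_mulVec_sum, ← Finset.sum_sub_distrib]
    refine Finset.sum_congr rfl fun t _ => ?_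
    rw [smul_smul, ← sub_smul, yChild, yRoot]
    congr 1
    ring
  rw [h]

lemma excessRisk_thetaTD_eq (φ : Fin d → ℝ) (p : ℝ) (i : Fin K) (ω : HierOmega d n K)
    (hω : IsUnit (regGram 0 ω.1).det) :
    excessRisk 1 (p • φ) (thetaTD φ i ω) =
      pHat i ω ^ 2 * (∑ t, ∑ u, olsKernel ω.1 t u * (ω.2.1 t * ω.2.1 u)) +
      2 * (pHat i ω * (pHat i ω - p)) *
        (∑ t, ω.2.1 t * (φ ⬝ᵥ (regGram 0 ω.1)⁻¹ *ᵥ ω.1 t)) +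
      (pHat i ω - p) ^ 2 * (φ ⬝ᵥ φ) := by
  have h : thetaTD φ i ω - p • φ = (pHat i ω - p) • φ +
      pHat i ω • ∑ t, ω.2.1 t • ((regGram 0 ω.1)⁻¹ *ᵥ ω.1 t) := by
    rw [thetaTD, thetaRoot, ← regGram_zero_eq_Smat, regGram_inv_mulVec_sum]
    simp only [yRoot, add_smul, Finset.sum_add_distrib, smul_add,
      sum_dotProduct_smul_regGram_inv ω.1 hω φ, sub_smul]
    abel
  have h1 : φ ⬝ᵥ (∑ t, ω.2.1 t • ((regGram 0 ω.1)⁻¹ *ᵥ ω.1 t)) =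
      ∑ t, ω.2.1 t * (φ ⬝ᵥ (regGram 0 ω.1)⁻¹ *ᵥ ω.1 t) := by
    simp only [dotProduct_sum, dotProduct_smul, smul_eq_mul]
  rw [excessRisk_one, h, ← dotProduct_self_sum_smul_regGram_inv, ← h1]
  simp only [add_dotProduct, dotProduct_add, smul_dotProduct, dotProduct_smul, smul_eq_mul]
  rw [dotProduct_comm (∑ t, ω.2.1 t • ((regGram 0 ω.1)⁻¹ *ᵥ ω.1 t)) φ]
  ring

lemma ae_isUnit_det_hierMeasure {νη : Measure ℝ} {νa : Measure (Fin K → ℝ)} (hn : d + 2 ≤ n) :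
    ∀ᵐ ω ∂hierMeasure d n K (stdGaussianPi d) νη νa, IsUnit (regGram 0 ω.1).det :=
  Measure.quasiMeasurePreserving_fst.ae (ae_isUnit_det_regGram_zero hn)

variable {νη : Measure ℝ} {νa : Measure (Fin K → ℝ)} [IsProbabilityMeasure νη]
  [IsProbabilityMeasure νa] {i : Fin K} {p s M τ : ℝ} {φ : Fin d → ℝ}

lemma HasExpectation.hier {f : (Fin n → Fin d → ℝ) → ℝ} {g : (Fin n → ℝ) → ℝ}
    {k : (Fin n → Fin K → ℝ) → ℝ} {u v w : ℝ}
    (hf : HasExpectation (stdDesign n d) f u)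
    (hg : HasExpectation (Measure.pi fun _ => νη) g v)
    (hk : HasExpectation (Measure.pi fun _ => νa) k w) :
    HasExpectation (hierMeasure d n K (stdGaussianPi d) νη νa)
      (fun ω => f ω.1 * (g ω.2.1 * k ω.2.2)) (u * (v * w)) :=
  hf.mul_prod (hg.mul_prod hk)

lemma integral_trace_regGram_inv (hn : d + 2 ≤ n) :
    ∑ t, ∫ X, olsKernel X t t ∂stdDesign n d = ∫ X, (regGram 0 X)⁻¹.trace ∂stdDesign n d := by
  rw [← integral_finsetSum _ fun t _ => integrable_olsKernel hn t t]
  simp only [sum_olsKernel_self]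

lemma exists_hasExpectation_excessRisk_thetaBU (hn : d + 2 ≤ n) (hτ : 0 < τ) (hs0 : 0 ≤ s)
    (hη0 : ∫ e, e ∂νη = 0) (hη : ∫ e, e ^ 2 ∂νη = τ)
    (hM : ∀ᵐ v ∂νa, |v i| ≤ M) (hp : ∫ v, v i ∂νa = p) (hs : ∫ v, (v i - p) ^ 2 ∂νa = s) :
    ∃ v, τ * (p ^ 2 + s) * ∫ X, (regGram 0 X)⁻¹.trace ∂stdDesign n d ≤ v ∧
      HasExpectation (hierMeasure d n K (stdGaussianPi d) νη νa)
        (fun ω => excessRisk 1 (p • φ) (thetaBU φ i ω)) v := by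
  have hc := fun t : Fin n => measurable_dotProduct_apply φ t
  have h1 := fun t u : Fin n => HasExpectation.hier (νη := νη) (νa := νa)
    ⟨integrable_olsKernel hn t u, rfl⟩ (hasExpectation_noise_mul hτ hη0 hη t u)
    (hasExpectation_prop_mul hM hp hs t u)
  have h2 := fun t u : Fin n => HasExpectation.hier (νη := νη) (νa := νa)
    ⟨integrable_olsKernel_mul hn t u (a := fun _ => 1) measurable_const (hc u) _
      (one_sq_le_weight φ) fun X => sq_dotProduct_le φ X u, rfl⟩
    ((hasExpectation_noise hτ hη0 hη).pi_eval t) (hasExpectation_prop_mul_sub hM hp hs t u)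
  have h3 := fun t u : Fin n => HasExpectation.hier (νη := νη) (νa := νa)
    ⟨integrable_olsKernel_mul hn t u (b := fun _ => 1) (hc t) measurable_const _
      (fun X => sq_dotProduct_le φ X t) (one_sq_le_weight φ), rfl⟩
    ((hasExpectation_noise hτ hη0 hη).pi_eval u) (hasExpectation_prop_mul_sub hM hp hs u t)
  have h4 := fun t u : Fin n => HasExpectation.hier (νη := νη) (νa := νa)
    ⟨integrable_olsKernel_mul hn t u (hc t) (hc u) _
      (fun X => sq_dotProduct_le φ X t) (fun X => sq_dotProduct_le φ X u), rfl⟩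
    (HasExpectation.const 1) (hasExpectation_prop_sub_mul hM hp hs t u)
  refine ⟨τ * (p ^ 2 + s) * ∫ X, (regGram 0 X)⁻¹.trace ∂stdDesign n d +
    s * ∑ t, ∫ X, olsKernel X t t * ((φ ⬝ᵥ X t) * (φ ⬝ᵥ X t)) ∂stdDesign n d, ?_, ?_⟩
  · refine le_add_of_nonneg_right (mul_nonneg hs0 (Finset.sum_nonneg fun t _ =>
      integral_nonneg fun X => ?_))
    exact mul_nonneg (olsKernel_self_nonneg X t) (mul_self_nonneg _)
  refine (HasExpectation.sum univ fun t : Fin n => HasExpectation.sum univ fun u : Fin n =>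
    (((h1 t u).add (h2 t u)).add (h3 t u)).add (h4 t u)).congr ?_ ?_
  · filter_upwards [ae_isUnit_det_hierMeasure hn] with ω hω
    rw [excessRisk_thetaBU_eq φ p i ω hω]
    exact Finset.sum_congr rfl fun t _ => Finset.sum_congr rfl fun u _ => by ring
  · rw [← integral_trace_regGram_inv hn, Finset.mul_sum, Finset.mul_sum, ← Finset.sum_add_distrib]
    refine Finset.sum_congr rfl fun t _ => ?_
    rw [Finset.sum_eq_single t (fun u _ hu => by simp [hu.symm]) (by simp)]
    simp
    ring

lemma hasExpectation_excessRisk_thetaTD (hn : d + 2 ≤ n) (hτ : 0 < τ)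
    (hη0 : ∫ e, e ∂νη = 0) (hη : ∫ e, e ^ 2 ∂νη = τ)
    (hM : ∀ᵐ v ∂νa, |v i| ≤ M) (hp : ∫ v, v i ∂νa = p) (hs : ∫ v, (v i - p) ^ 2 ∂νa = s) :
    HasExpectation (hierMeasure d n K (stdGaussianPi d) νη νa)
      (fun ω => excessRisk 1 (p • φ) (thetaTD φ i ω))
      (τ * (p ^ 2 + s / n) * (∫ X, (regGram 0 X)⁻¹.trace ∂stdDesign n d) +
        s / n * (φ ⬝ᵥ φ)) := by
  have hn0 : n ≠ 0 := by omega
  have h1 := fun t u : Fin n => HasExpectation.hier (νη := νη) (νa := νa)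
    ⟨integrable_olsKernel hn t u, rfl⟩ (hasExpectation_noise_mul hτ hη0 hη t u)
    (hasExpectation_mean_sq hn0 hM hp hs)
  have h2 := fun t : Fin n => HasExpectation.hier (νη := νη) (νa := νa)
    ⟨integrable_dotProduct_regGram_inv_mulVec hn φ t, rfl⟩
    ((hasExpectation_noise hτ hη0 hη).pi_eval t) (hasExpectation_mean_mul_sub hn0 hM hp hs)
  have h3 := HasExpectation.hier (νη := νη) (νa := νa)
    (HasExpectation.const (μ := stdDesign n d) (φ ⬝ᵥ φ))
    (HasExpectation.const 1) (hasExpectation_mean_sub_sq hn0 hM hp hs)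
  refine (((HasExpectation.sum univ fun t : Fin n => HasExpectation.sum univ fun u : Fin n =>
    h1 t u).add ((HasExpectation.sum univ h2).const_mul 2)).add h3).congr ?_ ?_
  · filter_upwards [ae_isUnit_det_hierMeasure hn] with ω hω
    rw [excessRisk_thetaTD_eq φ p i ω hω]
    simp only [pHat, Finset.mul_sum]
    congr 1
    · congr 1
      · exact Finset.sum_congr rfl fun t _ => Finset.sum_congr rfl fun u _ => by ring
      · exact Finset.sum_congr rfl fun t _ => by ring
    · ring
  · rw [← integral_trace_regGram_inv hn, Finset.mul_sum]
    simp [Finset.sum_ite_eq]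
    rw [mul_comm (φ ⬝ᵥ φ)]
    congr 1
    exact Finset.sum_congr rfl fun t _ => by ring

end StandardDesign

section Whitening

variable {d n K : ℕ} {A : Matrix (Fin d) (Fin d) ℝ}

/-- The action of an invertible matrix on the covariates. -/
def mulVecCovariates (n K : ℕ) (A : Matrix (Fin d) (Fin d) ℝ) (hA : IsUnit A.det) :
    HierOmega d n K ≃ᵐ HierOmega d n K where
  toFun ω := (fun t => A *ᵥ ω.1 t, ω.2)
  invFun ω := (fun t => A⁻¹ *ᵥ ω.1 t, ω.2)
  left_inv ω := by simp [mulVec_mulVec, nonsing_inv_mul _ hA]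
  right_inv ω := by simp [mulVec_mulVec, mul_nonsing_inv _ hA]
  measurable_toFun := Continuous.measurable (by simp only [Equiv.coe_fn_mk]; fun_prop)
  measurable_invFun := Continuous.measurable (by simp only [Equiv.coe_fn_symm_mk]; fun_prop)

lemma measurePreserving_mulVecCovariates (hA : IsUnit A.det) (νη : Measure ℝ)
    (νa : Measure (Fin K → ℝ)) [IsProbabilityMeasure νη] [IsProbabilityMeasure νa] :
    MeasurePreserving (mulVecCovariates n K A hA) (hierMeasure d n K (stdGaussianPi d) νη νa)
      (hierMeasure d n K ((stdGaussianPi d).map fun z => A *ᵥ z) νη νa) := by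
  have hm : Measurable fun z : Fin d → ℝ => A *ᵥ z := Continuous.measurable (by fun_prop)
  have : IsProbabilityMeasure ((stdGaussianPi d).map fun z => A *ᵥ z) :=
    Measure.isProbabilityMeasure_map hm.aemeasurable
  have h : MeasurePreserving (fun (X : Fin n → Fin d → ℝ) t => A *ᵥ X t)
      (Measure.pi fun _ => stdGaussianPi d)
      (Measure.pi fun _ => (stdGaussianPi d).map fun z => A *ᵥ z) :=
    ⟨by fun_prop, Measure.pi_map_pi fun _ => hm.aemeasurable⟩
  exact h.prod (MeasurePreserving.id _)

lemma Smat_mulVecCovariates (hA : IsUnit A.det) (ω : HierOmega d n K) :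
    Smat (mulVecCovariates n K A hA ω) = A * Smat ω * Aᵀ := by
  simp only [Smat, Finset.mul_sum, Finset.sum_mul]
  refine Finset.sum_congr rfl fun t _ => ?_
  rw [mul_vecMulVec, vecMulVec_mul, vecMul_transpose]
  rfl

lemma Smat_inv_mulVec_mulVecCovariates (hA : IsUnit A.det) (ω : HierOmega d n K)
    (r : Fin n → ℝ) :
    (Smat (mulVecCovariates n K A hA ω))⁻¹ *ᵥ (∑ t, r t • (mulVecCovariates n K A hA ω).1 t) =
      Aᵀ⁻¹ *ᵥ ((Smat ω)⁻¹ *ᵥ ∑ t, r t • ω.1 t) := by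
  have h : ∑ t, r t • (mulVecCovariates n K A hA ω).1 t = A *ᵥ ∑ t, r t • ω.1 t := by
    simp only [mulVec_sum, mulVec_smul]
    rfl
  rw [Smat_mulVecCovariates, h, Matrix.mul_inv_rev, Matrix.mul_inv_rev, mulVec_mulVec,
    Matrix.mul_assoc, Matrix.mul_assoc, nonsing_inv_mul _ hA, Matrix.mul_one, mulVec_mulVec]

lemma yRoot_mulVecCovariates (hA : IsUnit A.det) (θ : Fin d → ℝ) (t : Fin n)
    (ω : HierOmega d n K) :
    yRoot θ t (mulVecCovariates n K A hA ω) = yRoot (Aᵀ *ᵥ θ) t ω := by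
  simp only [yRoot, mulVec_transpose, ← dotProduct_mulVec]
  rfl

lemma thetaBU_mulVecCovariates (hA : IsUnit A.det) (θ : Fin d → ℝ) (i : Fin K)
    (ω : HierOmega d n K) :
    thetaBU θ i (mulVecCovariates n K A hA ω) = Aᵀ⁻¹ *ᵥ thetaBU (Aᵀ *ᵥ θ) i ω := by
  simp only [thetaBU, Smat_inv_mulVec_mulVecCovariates, yChild, yRoot_mulVecCovariates]
  rfl

lemma thetaTD_mulVecCovariates (hA : IsUnit A.det) (θ : Fin d → ℝ) (i : Fin K)
    (ω : HierOmega d n K) :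
    thetaTD θ i (mulVecCovariates n K A hA ω) = Aᵀ⁻¹ *ᵥ thetaTD (Aᵀ *ᵥ θ) i ω := by
  simp only [thetaTD, thetaRoot, Smat_inv_mulVec_mulVecCovariates, yRoot_mulVecCovariates,
    mulVec_smul]
  rfl

lemma excessRisk_mul_transpose (hA : IsUnit A.det) (p : ℝ) (θ w : Fin d → ℝ) :
    excessRisk (A * Aᵀ) (p • θ) (Aᵀ⁻¹ *ᵥ w) = excessRisk 1 (p • (Aᵀ *ᵥ θ)) w := by
  have hA' : IsUnit Aᵀ.det := by rwa [det_transpose]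
  have h : Aᵀ *ᵥ (Aᵀ⁻¹ *ᵥ w - p • θ) = w - p • (Aᵀ *ᵥ θ) := by
    rw [mulVec_sub, mulVec_mulVec, mul_nonsing_inv _ hA', one_mulVec, mulVec_smul]
  rw [excessRisk_one, excessRisk, ← mulVec_mulVec, dotProduct_mulVec, ← mulVec_transpose, h]

lemma integral_excessRisk_thetaBU (hA : IsUnit A.det) (νη : Measure ℝ)
    (νa : Measure (Fin K → ℝ)) [IsProbabilityMeasure νη] [IsProbabilityMeasure νa]
    (p : ℝ) (θ : Fin d → ℝ) (i : Fin K) :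
    ∫ ω, excessRisk (A * Aᵀ) (p • θ) (thetaBU θ i ω)
        ∂hierMeasure d n K ((stdGaussianPi d).map fun z => A *ᵥ z) νη νa =
      ∫ ω, excessRisk 1 (p • (Aᵀ *ᵥ θ)) (thetaBU (Aᵀ *ᵥ θ) i ω)
        ∂hierMeasure d n K (stdGaussianPi d) νη νa := by
  rw [← (measurePreserving_mulVecCovariates hA νη νa).integral_comp']
  simp only [thetaBU_mulVecCovariates, excessRisk_mul_transpose hA]

lemma integral_excessRisk_thetaTD (hA : IsUnit A.det) (νη : Measure ℝ)
    (νa : Measure (Fin K → ℝ)) [IsProbabilityMeasure νη] [IsProbabilityMeasure νa]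
    (p : ℝ) (θ : Fin d → ℝ) (i : Fin K) :
    ∫ ω, excessRisk (A * Aᵀ) (p • θ) (thetaTD θ i ω)
        ∂hierMeasure d n K ((stdGaussianPi d).map fun z => A *ᵥ z) νη νa =
      ∫ ω, excessRisk 1 (p • (Aᵀ *ᵥ θ)) (thetaTD (Aᵀ *ᵥ θ) i ω)
        ∂hierMeasure d n K (stdGaussianPi d) νη νa := by
  rw [← (measurePreserving_mulVecCovariates hA νη νa).integral_comp']
  simp only [thetaTD_mulVecCovariates, excessRisk_mul_transpose hA]

end Whitening

/-- The comparison of the two expected risks per child when `p = 1 / K` and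
`s = p (1 - p) / 2`, where `D` is the expected trace of the inverse Gram matrix. -/
lemma min_div_nine_mul_le {d n K D p s : ℝ} (hd : 1 ≤ d) (hK : 1 ≤ K) (hn : 2 * d ≤ n)
    (hD : d / n ≤ D) (hp : p = 1 / K) (hs : s = (1 / K) * (1 - 1 / K) / 2) :
    min d K / 9 * ((p ^ 2 + s / n) * D + s / n) ≤ (p ^ 2 + s) * D := by
  have hn0 : 0 < n := by linarith
  have hD0 : 0 < D := lt_of_lt_of_le (by positivity) hD
  obtain ⟨r, hr⟩ : ∃ r, r = n⁻¹ := ⟨_, rfl⟩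
  have hr0 : 0 < r := by rw [hr]; positivity
  have hdr : d * r ≤ D := by rwa [hr, ← div_eq_mul_inv]
  have hdr' : d * r ≤ 1 / 2 := by
    rw [hr, ← div_eq_mul_inv, div_le_iff₀ hn0]
    linarith
  have hs' : s = p ^ 2 * ((K - 1) / 2) := by
    rw [hs, hp]
    field_simp
  have hK1 : 0 ≤ (K - 1) / 2 := by linarith
  have hm0 : 0 ≤ min d K := le_min (by linarith) (by linarith)
  have h1 : min d K * D ≤ K * D := mul_le_mul_of_nonneg_right (min_le_right _ _) hD0.le
  have hmr : min d K * r ≤ d * r := mul_le_mul_of_nonneg_right (min_le_left _ _) hr0.le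
  have h2 : min d K * r * ((K - 1) / 2) * D ≤ 1 / 2 * ((K - 1) / 2) * D := by
    gcongr
    exact hmr.trans hdr'
  have h3 : min d K * r * ((K - 1) / 2) ≤ D * ((K - 1) / 2) := by
    gcongr
    exact hmr.trans hdr
  have h4 : 0 ≤ K * D := by positivity
  have h5 : min d K / 9 * ((1 + (K - 1) / 2 * r) * D + (K - 1) / 2 * r) ≤
      (1 + (K - 1) / 2) * D := by
    nlinarith
  have h6 := mul_le_mul_of_nonneg_left h5 (sq_nonneg p)
  rw [hs', div_eq_mul_inv (p ^ 2 * ((K - 1) / 2)) n, ← hr]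
  linarith

/-- In the two-level hierarchical linear regression model with proportion
moments matching the symmetric Dirichlet distribution `Dir(α)` with `α_i = 1/K`
(so `p_i = 1/K` and `s_i = (1/K)(1 − 1/K)/2`), with `θ₀ᵀΣθ₀ = σ²` and `n ≥ max(2d, 6)`,
the ratio of total expected excess risks of the bottom-up and top-down estimators is at
least `min(d, K)/9`. -/
theorem bottomUp_topDown_risk_ratio_dirichlet
    (d n K : ℕ) (hd : 1 ≤ d) (hK : 1 ≤ K) (hn : max (2 * d) 6 ≤ n)
    (C : Matrix (Fin d) (Fin d) ℝ) (hC : C.PosDef)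
    (θ₀ : Fin d → ℝ) (σ : ℝ) (hσ : 0 < σ ^ 2)
    (νx : Measure (Fin d → ℝ)) (νη : Measure ℝ) (νa : Measure (Fin K → ℝ))
    [IsProbabilityMeasure νη] [IsProbabilityMeasure νa]
    (hx : IsCenteredGaussian νx C)
    (hηmean : ∫ e, e ∂νη = 0)
    (hηvar : ∫ e, e ^ 2 ∂νη = σ ^ 2)
    (p s : Fin K → ℝ)
    (hamean : ∀ i, ∫ v, v i ∂νa = p i)
    (havar : ∀ i, ∫ v, (v i - p i) ^ 2 ∂νa = s i)
    (habdd : ∃ M : ℝ, ∀ᵐ v ∂νa, ∀ i, |v i| ≤ M)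
    (hp : ∀ i, p i = 1 / K)
    (hs : ∀ i, s i = (1 / K) * (1 - 1 / K) / 2)
    (hθ : θ₀ ⬝ᵥ C.mulVec θ₀ = σ ^ 2) :
    (min d K : ℝ) / 9 ≤
      (∑ i : Fin K, ∫ ω, excessRisk C (p i • θ₀) (thetaBU θ₀ i ω)
          ∂(hierMeasure d n K νx νη νa)) /
        (∑ i : Fin K, ∫ ω, excessRisk C (p i • θ₀) (thetaTD θ₀ i ω)
          ∂(hierMeasure d n K νx νη νa)) := by
  obtain ⟨A, rfl, rfl⟩ := hx
  have hA : IsUnit A.det := by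
    have h := hC.det_pos
    rw [det_mul] at h
    exact (left_ne_zero_of_mul h.ne').isUnit
  obtain ⟨M, hM⟩ := habdd
  have hdn : d + 2 ≤ n := by omega
  have hφ : (Aᵀ *ᵥ θ₀) ⬝ᵥ (Aᵀ *ᵥ θ₀) = σ ^ 2 := by
    rw [← hθ, ← mulVec_mulVec, dotProduct_mulVec θ₀ A, ← mulVec_transpose]
  have hd' : (1 : ℝ) ≤ d := by exact_mod_cast hd
  have hK' : (1 : ℝ) ≤ K := by exact_mod_cast hK
  have hn' : 2 * (d : ℝ) ≤ n := by exact_mod_cast (le_max_left _ _).trans hn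
  have hn0 : (0 : ℝ) < n := by linarith
  have hD := div_le_integral_trace_regGram_inv hdn
  set D := ∫ X, (regGram 0 X)⁻¹.trace ∂stdDesign n d
  have hD0 : 0 < D := lt_of_lt_of_le (by positivity) hD
  have hs0 : ∀ i, 0 ≤ s i := fun i => by
    rw [← havar i]
    exact integral_nonneg fun _ => sq_nonneg _
  simp_rw [integral_excessRisk_thetaBU hA, integral_excessRisk_thetaTD hA]
  have hTD : ∀ i, ∫ ω, excessRisk 1 (p i • (Aᵀ *ᵥ θ₀)) (thetaTD (Aᵀ *ᵥ θ₀) i ω)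
      ∂hierMeasure d n K (stdGaussianPi d) νη νa =
      σ ^ 2 * ((p i ^ 2 + s i / n) * D + s i / n) := fun i => by
    rw [(hasExpectation_excessRisk_thetaTD hdn hσ hηmean hηvar (hM.mono fun v hv => hv i)
      (hamean i) (havar i)).2, hφ]
    ring
  have hBU : ∀ i, min (d : ℝ) K / 9 * (σ ^ 2 * ((p i ^ 2 + s i / n) * D + s i / n)) ≤
      ∫ ω, excessRisk 1 (p i • (Aᵀ *ᵥ θ₀)) (thetaBU (Aᵀ *ᵥ θ₀) i ω)
        ∂hierMeasure d n K (stdGaussianPi d) νη νa := fun i => by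
    obtain ⟨v, hv, hvE⟩ := exists_hasExpectation_excessRisk_thetaBU (φ := Aᵀ *ᵥ θ₀) hdn hσ (hs0 i)
      hηmean hηvar (hM.mono fun v hv => hv i) (hamean i) (havar i)
    rw [hvE.2]
    refine le_trans ?_ hv
    have h := mul_le_mul_of_nonneg_left (min_div_nine_mul_le hd' hK' hn' hD (hp i) (hs i)) hσ.le
    linarith
  simp_rw [hTD]
  have : Nonempty (Fin K) := ⟨⟨0, hK⟩⟩
  have hpos : 0 < ∑ i, σ ^ 2 * ((p i ^ 2 + s i / n) * D + s i / n) := by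
    refine Finset.sum_pos (fun i _ => ?_) Finset.univ_nonempty
    have hpi : 0 < p i := by rw [hp i]; positivity
    have hsi := hs0 i
    positivity
  rw [le_div_iff₀ hpos, Finset.mul_sum]
  exact Finset.sum_le_sum fun i _ => hBU i

end
end

section
/- For all integers d ≥ 1, K ≥ 1 and n ≥ max(2d, 6), defining R_b = ((1 − 1/K)/2 + 1/K) · d/(n−d−1) and R_t = (1 − 1/K)/(2n) + ((1 − 1/K)/(2n) + 1/K) · d/(n−d−1), the ratio satisfies R_b / R_t ≥ min(d, K)/9. -/
/-- For all integers `d ≥ 1`, `K ≥ 1` and `n ≥ max(2d, 6)`, with the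
normalized total expected excess risks `R_b = ((1 − 1/K)/2 + 1/K) · d/(n−d−1)` of the
bottom-up estimator and `R_t = (1 − 1/K)/(2n) + ((1 − 1/K)/(2n) + 1/K) · d/(n−d−1)` of the
top-down estimator (under symmetric Dirichlet proportion moments with `α_i = 1/K`), the
ratio satisfies `R_b / R_t ≥ min(d, K)/9`. -/
theorem risk_ratio_algebraic (d K n : ℕ) (hd : 1 ≤ d) (hK : 1 ≤ K)
    (hn : max (2 * d) 6 ≤ n) :
    (min d K : ℝ) / 9 ≤
      (((1 - 1 / (K : ℝ)) / 2 + 1 / K) * (d / ((n : ℝ) - d - 1))) /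
        ((1 - 1 / (K : ℝ)) / (2 * n) +
          ((1 - 1 / (K : ℝ)) / (2 * n) + 1 / K) * (d / ((n : ℝ) - d - 1))) := by
  have hd' : (1 : ℝ) ≤ d := by exact_mod_cast hd
  have hK' : (1 : ℝ) ≤ K := by exact_mod_cast hK
  have hnd : (d : ℝ) + 3 ≤ n := by
    have : d + 3 ≤ n := by omega
    exact_mod_cast this
  have hm : 0 < (n : ℝ) - d - 1 := by linarith
  have hn0 : (0 : ℝ) < n := by linarith
  have hK0 : (0 : ℝ) < K := by linarith
  have hden : 0 < ((K : ℝ) - 1) * (n - 1) + 2 * d * n := by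
    have h₁ : 0 ≤ ((K : ℝ) - 1) * (n - 1) := mul_nonneg (by linarith) (by linarith)
    positivity
  have hRb : ((1 - 1 / (K : ℝ)) / 2 + 1 / K) * (d / ((n : ℝ) - d - 1)) =
      ((K + 1) * d * n) / (2 * K * n * (n - d - 1)) := by
    field_simp
    ring
  have hRt : (1 - 1 / (K : ℝ)) / (2 * n) +
      ((1 - 1 / (K : ℝ)) / (2 * n) + 1 / K) * (d / ((n : ℝ) - d - 1)) =
      ((K - 1) * (n - 1) + 2 * d * n) / (2 * K * n * (n - d - 1)) := by
    field_simp
    ring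
  rw [hRb, hRt, div_div_div_cancel_right₀ (by positivity), div_le_div_iff₀ (by norm_num) hden]
  have hmin₁ : min (d : ℝ) K * ((K - 1) * (n - 1)) ≤ d * ((K - 1) * n) := by
    have : (0 : ℝ) ≤ K - 1 := by linarith
    have : (0 : ℝ) ≤ n - 1 := by linarith
    gcongr
    · exact min_le_left _ _
    · linarith
  have hmin₂ : min (d : ℝ) K * (2 * d * n) ≤ K * (2 * d * n) := by
    gcongr
    exact min_le_right _ _
  have hdn : 0 < (d : ℝ) * n := by positivity
  nlinarith [mul_pos hdn hK0]
end

section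
/- For all integers d ≥ 1, K ≥ 1 and n ≥ max(2d, 6): (i) R_t := (1 − 1/K)/(2n) + ((1 − 1/K)/(2n) + 1/K) · d/(n−d−1) ≤ (5/4)/n + 3d/(nK), and (ii) R_b := ((1 − 1/K)/2 + 1/K) · d/(n−d−1) ≥ d/(2n); i.e., the top-down normalized risk is O(1/n + d/(nK)) and the bottom-up normalized risk is Ω(d/n). -/
/-- For all integers `d ≥ 1`, `K ≥ 1` and `n ≥ max(2d, 6)`:
(i) the normalized top-down risk
`R_t = (1 − 1/K)/(2n) + ((1 − 1/K)/(2n) + 1/K) · d/(n−d−1)` satisfies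
`R_t ≤ (5/4)/n + 3d/(nK)` (i.e. `R_t = O(1/n + d/(nK))`), and
(ii) the normalized bottom-up risk `R_b = ((1 − 1/K)/2 + 1/K) · d/(n−d−1)` satisfies
`R_b ≥ d/(2n)` (i.e. `R_b = Ω(d/n)`). -/
theorem topDown_risk_upper_and_bottomUp_risk_lower (d K n : ℕ)
    (hd : 1 ≤ d) (hK : 1 ≤ K) (hn : max (2 * d) 6 ≤ n) :
    ((1 - 1 / (K : ℝ)) / (2 * n) +
        ((1 - 1 / (K : ℝ)) / (2 * n) + 1 / K) * (d / ((n : ℝ) - d - 1)) ≤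
      (5 / 4) / n + 3 * d / (n * K)) ∧
    ((d : ℝ) / (2 * n) ≤
      ((1 - 1 / (K : ℝ)) / 2 + 1 / K) * (d / ((n : ℝ) - d - 1))) := by
  obtain ⟨hnd, hn6⟩ := max_le_iff.mp hn
  have hd' : (1 : ℝ) ≤ d := by exact_mod_cast hd
  have hK' : (1 : ℝ) ≤ K := by exact_mod_cast hK
  have hnd' : 2 * (d : ℝ) ≤ n := by exact_mod_cast hnd
  have hn6' : (6 : ℝ) ≤ n := by exact_mod_cast hn6
  have hn0 : (0 : ℝ) < n := by linarith
  have hm : (n : ℝ) / 3 ≤ (n : ℝ) - d - 1 := by linarith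
  have hm0 : (0 : ℝ) < (n : ℝ) - d - 1 := by linarith
  have hu0 : (0 : ℝ) ≤ 1 / K := by positivity
  have hu1 : 1 / (K : ℝ) ≤ 1 := div_le_one_of_le₀ hK' (by linarith)
  have hq_le : (d : ℝ) / ((n : ℝ) - d - 1) ≤ 3 * d / n := by
    rw [div_le_div_iff₀ hm0 hn0]
    nlinarith
  have hq_ge : (d : ℝ) / n ≤ d / ((n : ℝ) - d - 1) := by
    gcongr
    linarith
  have hq_le' : (d : ℝ) / ((n : ℝ) - d - 1) ≤ 3 / 2 :=
    hq_le.trans (by rw [div_le_div_iff₀ hn0 two_pos]; linarith)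
  have hq0 : (0 : ℝ) ≤ d / ((n : ℝ) - d - 1) := by positivity
  rw [show 3 * (d : ℝ) / (n * K) = 1 / K * (3 * d / n) by ring,
    show (d : ℝ) / (2 * n) = d / n / 2 by ring]
  generalize (d : ℝ) / ((n : ℝ) - d - 1) = q at *
  generalize 1 / (K : ℝ) = u at *
  constructor
  · have hfirst : (1 - u) * (1 + q) / (2 * n) ≤ (5 / 2) / (2 * n) := by
      gcongr
      nlinarith
    calc (1 - u) / (2 * n) + ((1 - u) / (2 * n) + u) * q
        = (1 - u) * (1 + q) / (2 * n) + u * q := by ring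
      _ ≤ (5 / 2) / (2 * n) + u * (3 * d / n) := by gcongr
      _ = (5 / 4) / n + u * (3 * d / n) := by ring
  · nlinarith [mul_nonneg hu0 hq0]
end
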